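/- There exist constants M > 0 and ν > 0, depending only on a, q, α₁, α₂, β₁, γ₁, μ₁ (and not on the solution), such that every classical solution of system (S) satisfies, for all t ≥ 0: E(t) ≤ M E(0) e^{−νt} and max_{x∈[0,1]} |u(t,x) − u_*|² ≤ M E(0) e^{−νt}. -/

import Mathlib

open Set MeasureTheory

/-- A classical solution of system (S): a wave equation with localized in-domain damping and
Wentzell (dynamic) boundary conditions. -/
structure ClassicalSolutionS (a q : ℝ → ℝ) (α₁ α₂ β₁ γ₁ μ₁ : ℝ) where
  u : ℝ → ℝ → ℝ
  ut : ℝ → ℝ → ℝ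
  ux : ℝ → ℝ → ℝ
  utt : ℝ → ℝ → ℝ
  dAux : ℝ → ℝ → ℝ
  η₁ : ℝ → ℝ
  η₂ : ℝ → ℝ
  ζ₁ : ℝ → ℝ
  hu_t : ∀ t ∈ Ici (0:ℝ), ∀ x ∈ Icc (0:ℝ) 1, HasDerivAt (fun s => u s x) (ut t x) t
  hu_x : ∀ t ∈ Ici (0:ℝ), ∀ x ∈ Icc (0:ℝ) 1, HasDerivAt (fun y => u t y) (ux t x) x
  hut_C1 : ContDiffOn ℝ 1 (fun p : ℝ × ℝ => ut p.1 p.2) (Ici (0:ℝ) ×ˢ Icc (0:ℝ) 1)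
  hux_C1 : ContDiffOn ℝ 1 (fun p : ℝ × ℝ => ux p.1 p.2) (Ici (0:ℝ) ×ˢ Icc (0:ℝ) 1)
  hu_tt : ∀ t ∈ Ici (0:ℝ), ∀ x ∈ Icc (0:ℝ) 1, HasDerivAt (fun s => ut s x) (utt t x) t
  haux_lip : ∀ t ∈ Ici (0:ℝ),
      ∃ K : NNReal, LipschitzOnWith K (fun x => a x * ux t x) (Icc (0:ℝ) 1)
  haux : ∀ t ∈ Ici (0:ℝ), ∀ᵐ x ∂(volume.restrict (Ioo (0:ℝ) 1)),
      HasDerivAt (fun y => a y * ux t y) (dAux t x) x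
  hPDE : ∀ t ∈ Ici (0:ℝ), ∀ᵐ x ∂(volume.restrict (Ioo (0:ℝ) 1)),
      utt t x - dAux t x = - q x * ut t x
  hbc1 : ∀ t ∈ Ici (0:ℝ), ut t 1 = η₁ t
  hbc0 : ∀ t ∈ Ici (0:ℝ), ut t 0 = ζ₁ t
  hη₁C1 : ContDiffOn ℝ 1 η₁ (Ici (0:ℝ))
  hη₂C1 : ContDiffOn ℝ 1 η₂ (Ici (0:ℝ))
  hζ₁C1 : ContDiffOn ℝ 1 ζ₁ (Ici (0:ℝ))
  hode1 : ∀ t ∈ Ici (0:ℝ), HasDerivAt η₁ (-α₁ * η₁ t - α₂ * η₂ t - β₁ * ux t 1) t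
  hode2 : ∀ t ∈ Ici (0:ℝ), HasDerivAt η₂ (η₁ t) t
  hode3 : ∀ t ∈ Ici (0:ℝ), HasDerivAt ζ₁ (-γ₁ * ζ₁ t + μ₁ * ux t 0) t

/-- The energy of a classical solution of system (S). -/
noncomputable def energyS {a q : ℝ → ℝ} {α₁ α₂ β₁ γ₁ μ₁ : ℝ}
    (sol : ClassicalSolutionS a q α₁ α₂ β₁ γ₁ μ₁) (t : ℝ) : ℝ :=
  (1/2) * (∫ x in (0:ℝ)..1, (sol.ut t x ^ 2 + a x * sol.ux t x ^ 2))
    + (a 1 / (2 * β₁)) * sol.η₁ t ^ 2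
    + (a 1 * α₂ / (2 * β₁)) * sol.η₂ t ^ 2
    + (a 0 / (2 * μ₁)) * sol.ζ₁ t ^ 2

/-- Assumption (A1): `a` is Lipschitz on `[0,1]` and bounded below and above by positive
constants `a_min ≤ a_max`. -/
def AssumptionA1 (a : ℝ → ℝ) (a_min a_max : ℝ) : Prop :=
  (∃ K : NNReal, LipschitzOnWith K a (Icc (0:ℝ) 1)) ∧ 0 < a_min ∧ a_min ≤ a_max ∧
    ∀ x ∈ Icc (0:ℝ) 1, a_min ≤ a x ∧ a x ≤ a_max

/-- Assumption (A2): `q` is bounded measurable, nonnegative a.e., and bounded below by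
`q_min > 0` (and above by `q_max`) a.e. on a nonempty open subinterval `ω = (c,d) ⊆ (0,1)`. -/
def AssumptionA2 (q : ℝ → ℝ) (c d q_min q_max : ℝ) : Prop :=
  Measurable q ∧ (∃ Q : ℝ, ∀ x ∈ Icc (0:ℝ) 1, |q x| ≤ Q) ∧
    (∀ᵐ x ∂(volume.restrict (Ioo (0:ℝ) 1)), 0 ≤ q x) ∧
    0 ≤ c ∧ c < d ∧ d ≤ 1 ∧ 0 < q_min ∧ q_min ≤ q_max ∧
    ∀ᵐ x ∂(volume.restrict (Ioo c d)), q_min ≤ q x ∧ q x ≤ q_max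

open Filter Topology

section Calculus

theorem ae_uIoc_of_ae_Ioo {b : ℝ} {P : ℝ → Prop} (hb : b ∈ Icc (0:ℝ) 1)
    (h : ∀ᵐ x ∂(volume.restrict (Ioo (0:ℝ) 1)), P x) :
    ∀ᵐ x ∂(volume.restrict (uIoc 0 b)), P x := by
  rw [uIoc_of_le hb.1, ← restrict_Ioo_eq_restrict_Ioc]
  exact ae_restrict_of_ae_restrict_of_subset (Ioo_subset_Ioo_right hb.2) h

/-- Fundamental theorem of calculus for an absolutely continuous function whose derivative is
known almost everywhere. -/
theorem integral_eq_sub_of_absolutelyContinuous {F F' : ℝ → ℝ} {b : ℝ} (hb : b ∈ Icc (0:ℝ) 1)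
    (hF : AbsolutelyContinuousOnInterval F 0 1)
    (h : ∀ᵐ x ∂(volume.restrict (Ioo (0:ℝ) 1)), HasDerivAt F (F' x) x) :
    IntervalIntegrable F' volume 0 b ∧ ∫ x in (0:ℝ)..b, F' x = F b - F 0 := by
  have hF' : AbsolutelyContinuousOnInterval F 0 b := hF.mono <| by
    rw [uIcc_of_le hb.1, uIcc_of_le zero_le_one]; exact Icc_subset_Icc_right hb.2
  have h' := ae_uIoc_of_ae_Ioo hb h
  have e : deriv F =ᵐ[volume.restrict (uIoc 0 b)] F' := by
    filter_upwards [h'] with x hx using hx.deriv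
  refine ⟨hF'.intervalIntegrable_deriv.congr_ae e, ?_⟩
  rw [← hF'.integral_deriv_eq_sub]
  exact (intervalIntegral.integral_congr_ae_restrict e).symm

theorem integral_mono_of_ae_Ioo {f g : ℝ → ℝ} (hf : IntervalIntegrable f volume 0 1)
    (hg : IntervalIntegrable g volume 0 1)
    (h : ∀ᵐ x ∂(volume.restrict (Ioo (0:ℝ) 1)), f x ≤ g x) :
    ∫ x in (0:ℝ)..1, f x ≤ ∫ x in (0:ℝ)..1, g x := by
  refine intervalIntegral.integral_mono_ae_restrict zero_le_one hf hg ?_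
  rw [← restrict_Ioo_eq_restrict_Icc]
  exact h

theorem sq_integral_le_integral_sq {f : ℝ → ℝ} {b : ℝ} (hb : b ∈ Icc (0:ℝ) 1)
    (hf : IntervalIntegrable f volume 0 1)
    (hf2 : IntervalIntegrable (fun x => f x ^ 2) volume 0 1) :
    (∫ x in (0:ℝ)..b, f x) ^ 2 ≤ ∫ x in (0:ℝ)..1, f x ^ 2 := by
  have hsub : uIcc 0 b ⊆ uIcc (0:ℝ) 1 := by
    rw [uIcc_of_le hb.1, uIcc_of_le zero_le_one]; exact Icc_subset_Icc_right hb.2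
  have hfb := hf.mono_set hsub
  have hf2b := hf2.mono_set hsub
  set m := ∫ x in (0:ℝ)..b, f x with hm
  have h0 : 0 ≤ ∫ x in (0:ℝ)..b, (f x - m) ^ 2 :=
    intervalIntegral.integral_nonneg hb.1 fun x _ => sq_nonneg _
  have h1 : ∫ x in (0:ℝ)..b, (f x - m) ^ 2 = (∫ x in (0:ℝ)..b, f x ^ 2) - 2 * m * m + b * m ^ 2 := by
    have : ∀ x, (f x - m) ^ 2 = f x ^ 2 - 2 * m * f x + m ^ 2 := fun x => by ring
    simp_rw [this]
    rw [intervalIntegral.integral_add (hf2b.sub (hfb.const_mul _)) (by simp),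
      intervalIntegral.integral_sub hf2b (hfb.const_mul _),
      intervalIntegral.integral_const_mul, ← hm]
    simp
  have h2 : ∫ x in (0:ℝ)..b, f x ^ 2 ≤ ∫ x in (0:ℝ)..1, f x ^ 2 :=
    intervalIntegral.integral_mono_interval le_rfl hb.1 hb.2
      (Eventually.of_forall fun x => sq_nonneg _) hf2
  nlinarith [hb.2, sq_nonneg m]

theorem continuousOn_slice {f : ℝ → ℝ → ℝ} {s : Set ℝ}
    (hf : ContinuousOn (fun z : ℝ × ℝ => f z.1 z.2) (s ×ˢ Icc (0:ℝ) 1)) {t : ℝ} (ht : t ∈ s) :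
    ContinuousOn (f t) (Icc (0:ℝ) 1) :=
  hf.comp (f := fun x : ℝ => (t, x)) (by fun_prop) fun _ hx => ⟨ht, hx⟩

theorem intervalIntegrable_of_continuousOn_Icc {f : ℝ → ℝ} {b : ℝ} (hb : b ∈ Icc (0:ℝ) 1)
    (hf : ContinuousOn f (Icc (0:ℝ) 1)) : IntervalIntegrable f volume 0 b :=
  ContinuousOn.intervalIntegrable <| by
    rw [uIcc_of_le hb.1]; exact hf.mono (Icc_subset_Icc_right hb.2)

/-- Joint continuity of the primitive of a function that is continuous on a strip. -/
theorem continuousOn_primitive_strip {f : ℝ → ℝ → ℝ}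
    (hf : ContinuousOn (fun z : ℝ × ℝ => f z.1 z.2) (Ici (0:ℝ) ×ˢ Icc (0:ℝ) 1)) :
    ContinuousOn (fun z : ℝ × ℝ => ∫ x in (0:ℝ)..z.2, f z.1 x) (Ici (0:ℝ) ×ˢ Icc (0:ℝ) 1) := by
  have hcl : Continuous fun z : ℝ × ℝ =>
      f (max z.1 0) (projIcc (0:ℝ) 1 zero_le_one z.2) := by
    refine hf.comp_continuous (f := fun z : ℝ × ℝ =>
      (max z.1 0, (projIcc (0:ℝ) 1 zero_le_one z.2 : ℝ))) ?_ ?_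
    · exact (by fun_prop : Continuous fun z : ℝ × ℝ => max z.1 0).prodMk
        (continuous_subtype_val.comp (continuous_projIcc.comp continuous_snd))
    · intro z
      exact ⟨mem_Ici.2 (le_max_right _ _), (projIcc (0:ℝ) 1 zero_le_one z.2).2⟩
  have h := intervalIntegral.continuous_parametric_primitive_of_continuous
    (μ := volume) (a₀ := 0)
    (f := fun t x => f (max t 0) (projIcc (0:ℝ) 1 zero_le_one x)) hcl
  refine h.continuousOn.congr ?_
  rintro ⟨t, b⟩ ⟨ht, hb⟩
  refine intervalIntegral.integral_congr fun x hx => ?_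
  simp only at hb ht
  rw [uIcc_of_le hb.1] at hx
  have hx1 : x ∈ Icc (0:ℝ) 1 := ⟨hx.1, hx.2.trans hb.2⟩
  simp only [max_eq_left (mem_Ici.1 ht), projIcc_of_mem zero_le_one hx1]

theorem continuousOn_integral_strip {f : ℝ → ℝ → ℝ}
    (hf : ContinuousOn (fun z : ℝ × ℝ => f z.1 z.2) (Ici (0:ℝ) ×ˢ Icc (0:ℝ) 1)) :
    ContinuousOn (fun t => ∫ x in (0:ℝ)..1, f t x) (Ici (0:ℝ)) :=
  (continuousOn_primitive_strip hf).comp (f := fun t : ℝ => (t, (1:ℝ))) (by fun_prop)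
    fun _ ht => ⟨ht, by simp⟩

/-- Differentiation under the integral sign on a strip. -/
theorem hasDerivAt_integral_strip {f f' : ℝ → ℝ → ℝ} {b t : ℝ} (hb : b ∈ Icc (0:ℝ) 1)
    (ht : 0 < t) (hf : ContinuousOn (fun z : ℝ × ℝ => f z.1 z.2) (Ici (0:ℝ) ×ˢ Icc (0:ℝ) 1))
    (hf' : ContinuousOn (fun z : ℝ × ℝ => f' z.1 z.2) (Ici (0:ℝ) ×ˢ Icc (0:ℝ) 1))
    (h : ∀ s, 0 < s → ∀ x ∈ Icc (0:ℝ) 1, HasDerivAt (fun r => f r x) (f' s x) s) :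
    HasDerivAt (fun s => ∫ x in (0:ℝ)..b, f s x) (∫ x in (0:ℝ)..b, f' t x) t := by
  have hcomp : IsCompact (Icc (t / 2) (2 * t) ×ˢ Icc (0:ℝ) 1) := isCompact_Icc.prod isCompact_Icc
  have hsub : Icc (t / 2) (2 * t) ×ˢ Icc (0:ℝ) 1 ⊆ Ici (0:ℝ) ×ˢ Icc (0:ℝ) 1 :=
    prod_mono (fun s hs => (by linarith [hs.1] : (0:ℝ) ≤ s)) le_rfl
  obtain ⟨C, hC⟩ := hcomp.exists_bound_of_continuousOn (hf'.mono hsub)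
  have hIoc : ∀ x, x ∈ uIoc 0 b → x ∈ Icc (0:ℝ) 1 := fun x hx => by
    rw [uIoc_of_le hb.1] at hx; exact ⟨hx.1.le, hx.2.trans hb.2⟩
  refine (intervalIntegral.hasDerivAt_integral_of_dominated_loc_of_deriv_le
    (s := Icc (t / 2) (2 * t)) (bound := fun _ => C)
    (Icc_mem_nhds (by linarith) (by linarith)) ?_ ?_ ?_ ?_ (by simp) ?_).2
  · filter_upwards [lt_mem_nhds ht] with s hs
    exact (intervalIntegrable_iff.1 (intervalIntegrable_of_continuousOn_Icc hb
      (continuousOn_slice hf (mem_Ici.2 hs.le)))).aestronglyMeasurable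
  · exact intervalIntegrable_of_continuousOn_Icc hb (continuousOn_slice hf (mem_Ici.2 ht.le))
  · exact (intervalIntegrable_iff.1 (intervalIntegrable_of_continuousOn_Icc hb
      (continuousOn_slice hf' (mem_Ici.2 ht.le)))).aestronglyMeasurable
  · exact Eventually.of_forall fun x hx s hs => hC (s, x) ⟨hs, hIoc x hx⟩
  · exact Eventually.of_forall fun x hx s hs => h s (by linarith [hs.1]) x (hIoc x hx)

/-- A differential inequality on `(0, ∞)` implies exponential decay. -/
theorem le_mul_exp_of_hasDerivAt_le {V V' : ℝ → ℝ} {ν : ℝ} (hV : ContinuousOn V (Ici 0))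
    (hV' : ∀ t, 0 < t → HasDerivAt V (V' t) t) (h : ∀ t, 0 < t → V' t ≤ -ν * V t)
    {t : ℝ} (ht : 0 ≤ t) : V t ≤ V 0 * Real.exp (-ν * t) := by
  have hanti : AntitoneOn (fun s => V s * Real.exp (ν * s)) (Ici 0) := by
    refine antitoneOn_of_hasDerivWithinAt_nonpos (convex_Ici 0) (hV.mul (by fun_prop))
      (f' := fun s => V' s * Real.exp (ν * s) + V s * (Real.exp (ν * s) * ν)) ?_ ?_
    · intro s hs
      rw [interior_Ici] at hs
      refine HasDerivAt.hasDerivWithinAt ((hV' s hs).mul ?_)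
      simpa using ((hasDerivAt_id s).const_mul ν).exp
    · intro s hs
      rw [interior_Ici] at hs
      nlinarith [h s hs, Real.exp_pos (ν * s)]
  have := hanti self_mem_Ici (mem_Ici.2 ht) ht
  simp only [mul_zero, Real.exp_zero, mul_one] at this
  rw [neg_mul, Real.exp_neg, ← div_eq_mul_inv, le_div_iff₀ (Real.exp_pos _)]
  exact this

end Calculus

section Weights

/-- A `C¹` bump supported in `(c, d)` with unit mass. -/
theorem exists_bump {c d : ℝ} (hcd : c < d) :
    ∃ ψ : ℝ → ℝ, ContDiff ℝ 1 ψ ∧ (∀ x, 0 ≤ ψ x) ∧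
      (∀ x, x ∉ Ioo c d → ψ x = 0 ∧ deriv ψ x = 0) ∧ ∫ x, ψ x = 1 := by
  let f : ContDiffBump ((c + d) / 2) :=
    ⟨(d - c) / 8, (d - c) / 4, by linarith, by linarith⟩
  have hts : tsupport (f.normed volume) ⊆ Ioo c d := by
    rw [f.tsupport_normed_eq, Real.closedBall_eq_Icc]
    intro x hx
    change x ∈ Icc ((c + d) / 2 - (d - c) / 4) ((c + d) / 2 + (d - c) / 4) at hx
    exact ⟨by linarith [hx.1], by linarith [hx.2]⟩
  refine ⟨f.normed volume, f.contDiff_normed, f.nonneg_normed, fun x hx => ⟨?_, ?_⟩,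
    f.integral_normed⟩
  · exact image_eq_zero_of_notMem_tsupport fun h => hx (hts h)
  · by_contra hne
    exact hx (hts (support_deriv_subset hne))

/-- A multiplier vanishing at both ends of `[0, 1]` which grows fast outside `(c, d)`. -/
theorem exists_multiplier {c d K : ℝ} (hc : 0 ≤ c) (hcd : c < d) (hd : d ≤ 1) (hK : 0 ≤ K) :
    ∃ h h' ψ ψ' : ℝ → ℝ, ∃ B : ℝ, 0 ≤ B ∧ h 0 = 0 ∧ h 1 = 0 ∧
      (∀ x, HasDerivAt h (h' x) x) ∧ Continuous h' ∧
      (∀ x, HasDerivAt ψ (ψ' x) x) ∧ Continuous ψ' ∧ (∀ x, 0 ≤ ψ x) ∧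
      (∀ x, x ∉ Ioo c d → ψ x = 0 ∧ ψ' x = 0) ∧
      ∀ x ∈ Icc (0:ℝ) 1, 1 - B * ψ x ≤ h' x - K * |h x| := by
  obtain ⟨ψ, hψ, hψ0, hψs, hψi⟩ := exists_bump hcd
  have hψc : Continuous ψ := hψ.continuous
  let Ψ : ℝ → ℝ := fun x => ∫ s in (0:ℝ)..x, ψ s
  have hΨd : ∀ x, HasDerivAt Ψ (ψ x) x := fun x => hψc.integral_hasStrictDerivAt 0 x |>.hasDerivAt
  have hΨ1 : Ψ 1 = 1 := by
    rw [← hψi]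
    refine intervalIntegral.integral_eq_integral_of_support_subset fun x hx => ?_
    by_contra hn
    exact hx (hψs x fun h => hn ⟨by linarith [h.1], by linarith [h.2]⟩).1
  have hΨ0 : Ψ 0 = 0 := intervalIntegral.integral_same
  have hmono : Monotone Ψ := monotone_of_hasDerivAt_nonneg hΨd hψ0
  set L := K + 1 with hL
  have hE1 : ∀ x, HasDerivAt (fun x => Real.exp (L * x)) (Real.exp (L * x) * L) x := fun x => by
    simpa using ((hasDerivAt_id x).const_mul L).exp
  have hE2 : ∀ x, HasDerivAt (fun x => Real.exp (L * (1 - x))) (-(Real.exp (L * (1 - x)) * L)) x :=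
    fun x => by simpa using (((hasDerivAt_id x).const_sub 1).const_mul L).exp
  refine ⟨fun x => (Real.exp (L * x) - 1) * (1 - Ψ x) - (Real.exp (L * (1 - x)) - 1) * Ψ x,
    fun x => (Real.exp (L * x) * L) * (1 - Ψ x) + (Real.exp (L * x) - 1) * (-ψ x) -
      ((-(Real.exp (L * (1 - x)) * L)) * Ψ x + (Real.exp (L * (1 - x)) - 1) * ψ x),
    ψ, deriv ψ, 2 * Real.exp L, by positivity, by simp [hΨ0], by simp [hΨ1], ?_, ?_, ?_,
    hψ.continuous_deriv le_rfl, hψ0, hψs, ?_⟩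
  · intro x
    exact (((hE1 x).sub_const 1).mul ((hΨd x).const_sub 1)).sub
      (((hE2 x).sub_const 1).mul (hΨd x))
  · have : Continuous Ψ := continuous_iff_continuousAt.2 fun x => (hΨd x).continuousAt
    fun_prop
  · exact fun x => (hψ.differentiable one_ne_zero x).hasDerivAt
  · intro x hx
    have h0 : 0 ≤ Ψ x := hΨ0 ▸ hmono hx.1
    have h1 : Ψ x ≤ 1 := hΨ1 ▸ hmono hx.2
    have hL0 : 0 ≤ L := by linarith
    have e1 : 1 ≤ Real.exp (L * x) := Real.one_le_exp (mul_nonneg hL0 hx.1)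
    have e2 : 1 ≤ Real.exp (L * (1 - x)) :=
      Real.one_le_exp (mul_nonneg hL0 (by linarith [hx.2]))
    have e3 : Real.exp (L * x) ≤ Real.exp L := Real.exp_le_exp.2 (by nlinarith [hx.2])
    have e4 : Real.exp (L * (1 - x)) ≤ Real.exp L := Real.exp_le_exp.2 (by nlinarith [hx.1])
    simp only
    generalize Real.exp (L * x) = A at *
    generalize Real.exp (L * (1 - x)) = A' at *
    have habs : |(A - 1) * (1 - Ψ x) - (A' - 1) * Ψ x| ≤ A * (1 - Ψ x) + A' * Ψ x - 1 := by
      have p1 : 0 ≤ (A - 1) * (1 - Ψ x) := mul_nonneg (by linarith) (by linarith)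
      have p2 : 0 ≤ (A' - 1) * Ψ x := mul_nonneg (by linarith) h0
      rw [abs_le]; constructor <;> nlinarith
    have hψ' : (A + A' - 2) * ψ x ≤ 2 * Real.exp L * ψ x :=
      mul_le_mul_of_nonneg_right (by linarith) (hψ0 x)
    have hg : 1 ≤ A * (1 - Ψ x) + A' * Ψ x := by nlinarith
    have := mul_le_mul_of_nonneg_left habs hK
    rw [hL]
    nlinarith

end Weights

section Slice

/-- A snapshot of the wave equation `y_t = (a p)_x - q y`, `p_t = y_x` at a fixed time. -/
structure WaveSlice (a q y p yt pt : ℝ → ℝ) : Prop where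
  a_ac : AbsolutelyContinuousOnInterval a 0 1
  y_ac : AbsolutelyContinuousOnInterval y 0 1
  p_ac : AbsolutelyContinuousOnInterval p 0 1
  yt_cont : ContinuousOn yt (Icc 0 1)
  pt_cont : ContinuousOn pt (Icc 0 1)
  y_deriv : ∀ x ∈ Ioo (0:ℝ) 1, HasDerivAt y (pt x) x
  flux_deriv : ∀ᵐ x ∂(volume.restrict (Ioo (0:ℝ) 1)),
    HasDerivAt (fun x => a x * p x) (yt x + q x * y x) x
  q_int : IntervalIntegrable q volume 0 1

namespace WaveSlice

variable {a q y p yt pt : ℝ → ℝ}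

theorem a_cont (S : WaveSlice a q y p yt pt) : ContinuousOn a (Icc 0 1) := by
  simpa using S.a_ac.continuousOn

theorem y_cont (S : WaveSlice a q y p yt pt) : ContinuousOn y (Icc 0 1) := by
  simpa using S.y_ac.continuousOn

theorem p_cont (S : WaveSlice a q y p yt pt) : ContinuousOn p (Icc 0 1) := by
  simpa using S.p_ac.continuousOn

theorem intervalIntegrable_q_mul (S : WaveSlice a q y p yt pt) {g : ℝ → ℝ} {b : ℝ}
    (hb : b ∈ Icc (0:ℝ) 1) (hg : ContinuousOn g (Icc 0 1)) :
    IntervalIntegrable (fun x => q x * g x) volume 0 b := by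
  have : IntervalIntegrable (fun x => q x * g x) volume 0 1 :=
    S.q_int.mul_continuousOn (by simpa using hg)
  refine this.mono_set ?_
  rw [uIcc_of_le hb.1, uIcc_of_le zero_le_one]; exact Icc_subset_Icc_right hb.2

theorem flux_eq (S : WaveSlice a q y p yt pt) {x : ℝ} (hx : x ∈ Icc (0:ℝ) 1) :
    a x * p x - a 0 * p 0 = (∫ s in (0:ℝ)..x, yt s) + ∫ s in (0:ℝ)..x, q s * y s := by
  rw [← intervalIntegral.integral_add (intervalIntegrable_of_continuousOn_Icc hx S.yt_cont)
    (S.intervalIntegrable_q_mul hx S.y_cont)]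
  exact ((integral_eq_sub_of_absolutelyContinuous hx (S.a_ac.fun_mul S.p_ac)
    S.flux_deriv).2).symm

theorem energy_identity (S : WaveSlice a q y p yt pt) :
    ∫ x in (0:ℝ)..1, (y x * yt x + a x * p x * pt x) =
      a 1 * p 1 * y 1 - a 0 * p 0 * y 0 - ∫ x in (0:ℝ)..1, q x * y x ^ 2 := by
  have h1 : (1:ℝ) ∈ Icc (0:ℝ) 1 := by simp
  have ha := S.a_cont
  have hy := S.y_cont
  have hp := S.p_cont
  have hyt := S.yt_cont
  have hpt := S.pt_cont
  have h := (integral_eq_sub_of_absolutelyContinuous h1 (S.y_ac.fun_mul (S.a_ac.fun_mul S.p_ac))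
    (F' := fun x => (y x * yt x + a x * p x * pt x) + q x * y x ^ 2) ?_).2
  · rw [intervalIntegral.integral_add
      (intervalIntegrable_of_continuousOn_Icc h1 (by fun_prop))
      (S.intervalIntegrable_q_mul h1 (by fun_prop))] at h
    linarith
  · filter_upwards [S.flux_deriv, ae_restrict_mem measurableSet_Ioo] with x hx hx'
    exact ((S.y_deriv x hx').mul hx).congr_deriv (by ring)

/-- The multiplier `h p` in the wave equation. -/
theorem multiplier_estimate (S : WaveSlice a q y p yt pt) {h h' ψ : ℝ → ℝ} {B K : ℝ}
    (ha0 : ∀ x ∈ Icc (0:ℝ) 1, 0 ≤ a x)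
    (hK : ∀ᵐ x ∂(volume.restrict (Ioo (0:ℝ) 1)), |deriv a x| ≤ K * a x) (hK0 : 0 ≤ K)
    (h0 : h 0 = 0) (h1 : h 1 = 0) (hd : ∀ x, HasDerivAt h (h' x) x) (hh' : Continuous h')
    (hψ : Continuous ψ) (hB : ∀ x ∈ Icc (0:ℝ) 1, 1 - B * ψ x ≤ h' x - K * |h x|) :
    ∫ x in (0:ℝ)..1, h x * (yt x * p x + y x * pt x) ≤
      ∫ x in (0:ℝ)..1, (-(1 / 2) * (1 - B * ψ x) * (y x ^ 2 + a x * p x ^ 2)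
        - q x * (h x * y x * p x)) := by
  have h01 : (1:ℝ) ∈ Icc (0:ℝ) 1 := by simp
  have ha := S.a_cont
  have hy := S.y_cont
  have hp := S.p_cont
  have hyt := S.yt_cont
  have hpt := S.pt_cont
  have hhc : Continuous h := continuous_iff_continuousAt.2 fun x => (hd x).continuousAt
  have hhC1 : ContDiff ℝ 1 h := by
    rw [contDiff_one_iff_deriv]
    refine ⟨fun x => (hd x).differentiableAt, ?_⟩
    rwa [show deriv h = h' from funext fun x => (hd x).deriv]
  have h_ac : AbsolutelyContinuousOnInterval h 0 1 :=
    hhC1.contDiffOn.absolutelyContinuousOnInterval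
  have hsum := (S.y_ac.fun_mul S.y_ac).fun_add ((S.a_ac.fun_mul S.p_ac).fun_mul S.p_ac)
  have F_ac := h_ac.fun_mul hsum
  set F : ℝ → ℝ := fun x => h x * (y x * y x + a x * p x * p x) with hF
  have hdiff : ∀ {f : ℝ → ℝ}, AbsolutelyContinuousOnInterval f 0 1 →
      ∀ᵐ x ∂(volume.restrict (Ioo (0:ℝ) 1)), DifferentiableAt ℝ f x := fun {f} hf => by
    filter_upwards [ae_restrict_of_ae hf.ae_differentiableAt,
      ae_restrict_mem measurableSet_Ioo] with x hx hx'
    exact hx (by rw [uIcc_of_le zero_le_one]; exact Ioo_subset_Icc_self hx')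
  obtain ⟨hFi, hFe⟩ := integral_eq_sub_of_absolutelyContinuous h01 F_ac (F' := deriv F)
    ((hdiff F_ac).mono fun x hx => hx.hasDerivAt)
  have hF0 : ∫ x in (0:ℝ)..1, deriv F x = 0 := by rw [hFe]; simp [hF, h0, h1]
  have i1 : IntervalIntegrable (fun x => -(1 / 2) * (1 - B * ψ x) * (y x ^ 2 + a x * p x ^ 2)
      - q x * (h x * y x * p x)) volume 0 1 :=
    (intervalIntegrable_of_continuousOn_Icc h01 (by fun_prop)).sub
      (S.intervalIntegrable_q_mul h01 (by fun_prop))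
  have i2 := hFi.const_mul (1 / 2)
  have key := integral_mono_of_ae_Ioo
    (f := fun x => h x * (yt x * p x + y x * pt x))
    (g := fun x => (-(1 / 2) * (1 - B * ψ x) * (y x ^ 2 + a x * p x ^ 2)
      - q x * (h x * y x * p x)) + 1 / 2 * deriv F x)
    (intervalIntegrable_of_continuousOn_Icc h01 (by fun_prop)) (i1.add i2) ?_
  · rw [intervalIntegral.integral_add i1 i2, intervalIntegral.integral_const_mul, hF0] at key
    linarith
  · filter_upwards [S.flux_deriv, hdiff S.a_ac, hdiff S.p_ac, hK,
      ae_restrict_mem measurableSet_Ioo] with x hw hax hpx hKx hx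
    have hxI := Ioo_subset_Icc_self hx
    have e1 := hw.unique (hax.hasDerivAt.mul hpx.hasDerivAt)
    have e2 : deriv F x = h' x * (y x * y x + a x * p x * p x) + h x *
        ((pt x * y x + y x * pt x) + ((yt x + q x * y x) * p x + a x * p x * deriv p x)) :=
      ((hd x).mul (((S.y_deriv x hx).mul (S.y_deriv x hx)).add (hw.mul hpx.hasDerivAt))).deriv
    have e3 : a x * p x * deriv p x = (yt x + q x * y x) * p x - deriv a x * p x ^ 2 := by
      rw [e1]; ring
    rw [e2, e3]
    have b1 : h x * deriv a x * p x ^ 2 ≤ K * |h x| * (a x * p x ^ 2) := by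
      have : h x * deriv a x ≤ |h x| * (K * a x) :=
        (le_abs_self _).trans (by rw [abs_mul]; gcongr)
      nlinarith [sq_nonneg (p x)]
    have b2 := mul_le_mul_of_nonneg_right (hB x hxI)
      (by have := ha0 x hxI; positivity : 0 ≤ y x ^ 2 + a x * p x ^ 2)
    have b3 : 0 ≤ K * |h x| * y x ^ 2 := by positivity
    nlinarith

/-- The localized multiplier `ψ Y`, where `Y` is a primitive of `y`. -/
theorem localized_identity (S : WaveSlice a q y p yt pt) {ψ ψ' Y Yt : ℝ → ℝ}
    (hd : ∀ x, HasDerivAt ψ (ψ' x) x) (hψ' : Continuous ψ') (h0 : ψ 0 = 0) (h1 : ψ 1 = 0)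
    (hY : ContinuousOn Y (Icc 0 1)) (hYd : ∀ x ∈ Ioo (0:ℝ) 1, HasDerivAt Y (y x) x)
    (hYt : ContinuousOn Yt (Icc 0 1)) :
    ∫ x in (0:ℝ)..1, ψ x * (pt x * Y x + p x * Yt x) =
      ∫ x in (0:ℝ)..1, (ψ x * p x * Yt x - ψ' x * y x * Y x - ψ x * y x ^ 2) := by
  have h01 : (1:ℝ) ∈ Icc (0:ℝ) 1 := by simp
  have hy := S.y_cont
  have hp := S.p_cont
  have hpt := S.pt_cont
  have hψ : Continuous ψ := continuous_iff_continuousAt.2 fun x => (hd x).continuousAt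
  have h := intervalIntegral.integral_eq_sub_of_hasDerivAt_of_le zero_le_one
    (f := fun x => ψ x * y x * Y x)
    (f' := fun x => (ψ' x * y x + ψ x * pt x) * Y x + ψ x * y x * y x) (by fun_prop)
    (fun x hx => (((hd x).mul (S.y_deriv x hx)).mul (hYd x hx)))
    (intervalIntegrable_of_continuousOn_Icc h01 (by fun_prop))
  rw [h0, h1] at h
  rw [← sub_eq_zero, ← intervalIntegral.integral_sub
    (intervalIntegrable_of_continuousOn_Icc h01 (by fun_prop))
    (intervalIntegrable_of_continuousOn_Icc h01 (by fun_prop))]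
  refine Eq.trans (intervalIntegral.integral_congr fun x _ => ?_) (h.trans (by simp))
  ring

end WaveSlice

end Slice

section Estimates

/-- Weights adapted to a coefficient `a` and a damping `q`, with all the bounds they satisfy. -/
structure AdaptedWeights (a q h h' ψ ψ' : ℝ → ℝ) (B K H m k Q : ℝ) : Prop where
  m_pos : 0 < m
  a_ge : ∀ x ∈ Icc (0:ℝ) 1, m ≤ a x
  a_cont : ContinuousOn a (Icc 0 1)
  K_nonneg : 0 ≤ K
  deriv_a : ∀ᵐ x ∂(volume.restrict (Ioo (0:ℝ) 1)), |deriv a x| ≤ K * a x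
  B_nonneg : 0 ≤ B
  h_zero : h 0 = 0
  h_one : h 1 = 0
  h_deriv : ∀ x, HasDerivAt h (h' x) x
  h'_cont : Continuous h'
  ψ_zero : ψ 0 = 0
  ψ_one : ψ 1 = 0
  ψ_deriv : ∀ x, HasDerivAt ψ (ψ' x) x
  ψ'_cont : Continuous ψ'
  ψ_nonneg : ∀ x, 0 ≤ ψ x
  growth : ∀ x ∈ Icc (0:ℝ) 1, 1 - B * ψ x ≤ h' x - K * |h x|
  H_nonneg : 0 ≤ H
  h_le : ∀ x ∈ Icc (0:ℝ) 1, |h x| ≤ H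
  ψ_le : ∀ x ∈ Icc (0:ℝ) 1, |ψ x| ≤ H
  ψ'_le : ∀ x ∈ Icc (0:ℝ) 1, |ψ' x| ≤ H
  k_pos : 0 < k
  supp : ∀ᵐ x ∂(volume.restrict (Ioo (0:ℝ) 1)), (ψ x = 0 ∧ ψ' x = 0) ∨ k ≤ q x
  Q_nonneg : 0 ≤ Q
  q_bound : ∀ᵐ x ∂(volume.restrict (Ioo (0:ℝ) 1)), 0 ≤ q x ∧ q x ≤ Q

namespace AdaptedWeights

variable {a q h h' ψ ψ' : ℝ → ℝ} {B K H m k Q : ℝ}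

theorem h_cont (W : AdaptedWeights a q h h' ψ ψ' B K H m k Q) : Continuous h :=
  continuous_iff_continuousAt.2 fun x => (W.h_deriv x).continuousAt

theorem ψ_cont (W : AdaptedWeights a q h h' ψ ψ' B K H m k Q) : Continuous ψ :=
  continuous_iff_continuousAt.2 fun x => (W.ψ_deriv x).continuousAt

end AdaptedWeights

theorem sq_primitive_le {y : ℝ → ℝ} (hy : ContinuousOn y (Icc 0 1)) (s : ℝ) {x : ℝ}
    (hx : x ∈ Icc (0:ℝ) 1) :
    ((∫ z in (0:ℝ)..x, y z) + s) ^ 2 ≤ 2 * (∫ z in (0:ℝ)..1, y z ^ 2) + 2 * s ^ 2 := by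
  have h01 : (1:ℝ) ∈ Icc (0:ℝ) 1 := by simp
  have := sq_integral_le_integral_sq hx (intervalIntegrable_of_continuousOn_Icc h01 hy)
    (intervalIntegrable_of_continuousOn_Icc h01 (by fun_prop))
  nlinarith [sq_nonneg ((∫ z in (0:ℝ)..x, y z) - s)]

theorem sq_damped_primitive_le {q y : ℝ → ℝ} {Q : ℝ} (hq : IntervalIntegrable q volume 0 1)
    (hqb : ∀ᵐ x ∂(volume.restrict (Ioo (0:ℝ) 1)), 0 ≤ q x ∧ q x ≤ Q)
    (hy : ContinuousOn y (Icc 0 1)) (r : ℝ) {x : ℝ} (hx : x ∈ Icc (0:ℝ) 1) :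
    ((∫ z in (0:ℝ)..x, q z * y z) + r) ^ 2 ≤
      2 * Q * (∫ z in (0:ℝ)..1, q z * y z ^ 2) + 2 * r ^ 2 := by
  have h01 : (1:ℝ) ∈ Icc (0:ℝ) 1 := by simp
  have hqy : IntervalIntegrable (fun z => q z * y z) volume 0 1 :=
    hq.mul_continuousOn (by simpa using hy)
  have hqy2 : IntervalIntegrable (fun z => q z * y z ^ 2) volume 0 1 :=
    hq.mul_continuousOn (by simpa using hy.fun_pow 2)
  have hdom : ∀ᵐ x ∂(volume.restrict (Ioo (0:ℝ) 1)),
      (q x * y x) ^ 2 ≤ Q * (q x * y x ^ 2) := by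
    filter_upwards [hqb] with x hx
    nlinarith [mul_le_mul_of_nonneg_right (mul_le_mul_of_nonneg_right hx.2 hx.1)
      (sq_nonneg (y x))]
  have hsq : IntervalIntegrable (fun z => (q z * y z) ^ 2) volume 0 1 := by
    refine (hqy2.const_mul Q).mono_fun ?_ ?_
    · exact (intervalIntegrable_iff.1 hqy).aestronglyMeasurable.pow 2
    · filter_upwards [ae_uIoc_of_ae_Ioo h01 hdom] with x hx
      rw [Real.norm_of_nonneg (sq_nonneg _)]
      exact hx.trans (le_abs_self _)
  have h1 := sq_integral_le_integral_sq hx hqy hsq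
  have h2 := integral_mono_of_ae_Ioo hsq (hqy2.const_mul Q) hdom
  rw [intervalIntegral.integral_const_mul] at h2
  nlinarith [sq_nonneg ((∫ z in (0:ℝ)..x, q z * y z) - r)]

theorem pointwise_decay_estimate {a q h ψ ψ' y p Y D B H m k Q Ybar Dbar : ℝ} (hm : 0 < m)
    (hk : 0 < k) (hB : 0 ≤ B) (hH : 0 ≤ H) (ba : m ≤ a) (hh : |h| ≤ H)
    (hψ : |ψ| ≤ H) (hψ' : |ψ'| ≤ H) (hsupp : (ψ = 0 ∧ ψ' = 0) ∨ k ≤ q) (hq0 : 0 ≤ q)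
    (hqQ : q ≤ Q) (bY : Y ^ 2 ≤ Ybar) (bD : D ^ 2 ≤ Dbar) :
    -(1 / 2) * (1 - B * ψ) * (y ^ 2 + a * p ^ 2) - q * (h * y * p) -
        B / 2 * (ψ * p * (a * p - D) - ψ' * y * Y - ψ * y ^ 2) ≤
      -(1 / 2) * y ^ 2 + -(3 / 8) * (a * p ^ 2) +
        (B * H / k + B ^ 2 * H ^ 2 / k + 4 * H ^ 2 * Q / m) * (q * y ^ 2) +
        ((1 / 16) * Ybar + B ^ 2 * H ^ 2 / m * Dbar) := by
  have hsq : ∀ z : ℝ, |z| ≤ H → z ^ 2 ≤ H ^ 2 := fun z hz => by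
    rw [← sq_abs]; gcongr
  have t1 : B * ψ * y ^ 2 + B / 2 * (ψ' * y * Y) ≤
      (1 / 16) * Ybar +
        (B * H / k + B ^ 2 * H ^ 2 / k) * (q * y ^ 2) := by
    have u : B / 2 * (ψ' * y * Y) ≤ (1 / 16) * Y ^ 2 + B ^ 2 * ψ' ^ 2 * y ^ 2 := by
      nlinarith [sq_nonneg (Y / 4 - B * (ψ' * y))]
    have v : B * ψ * y ^ 2 + B ^ 2 * ψ' ^ 2 * y ^ 2 ≤
        (B * H / k + B ^ 2 * H ^ 2 / k) * (q * y ^ 2) := by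
      rcases hsupp with ⟨z1, z2⟩ | hkq
      · rw [z1, z2]
        simp only [mul_zero, zero_mul, ne_eq, OfNat.ofNat_ne_zero, not_false_eq_true, zero_pow,
          add_zero]
        positivity
      · have w1 : B * ψ ≤ B * H / k * q := by
          have : B * ψ ≤ B * H :=
            mul_le_mul_of_nonneg_left ((le_abs_self _).trans hψ) hB
          calc B * ψ ≤ B * H := this
            _ = B * H / k * k := by field_simp
            _ ≤ _ := by gcongr
        have w2 : B ^ 2 * ψ' ^ 2 ≤ B ^ 2 * H ^ 2 / k * q := by
          calc B ^ 2 * ψ' ^ 2 ≤ B ^ 2 * H ^ 2 := by exact mul_le_mul_of_nonneg_left (hsq _ hψ') (sq_nonneg B)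
            _ = B ^ 2 * H ^ 2 / k * k := by field_simp
            _ ≤ _ := by gcongr
        have w3 := mul_le_mul_of_nonneg_right (add_le_add w1 w2) (sq_nonneg y)
        calc B * ψ * y ^ 2 + B ^ 2 * ψ' ^ 2 * y ^ 2 = (B * ψ + B ^ 2 * ψ' ^ 2) * y ^ 2 := by ring
          _ ≤ _ := w3
          _ = _ := by ring
    linarith
  have hmp : m * p ^ 2 ≤ a * p ^ 2 := by gcongr
  have t2 : B / 2 * (ψ * p * D) ≤
      (1 / 16) * (a * p ^ 2) + (B ^ 2 * H ^ 2 / m) * Dbar := by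
    have u : B / 2 * (ψ * p * D) ≤
        m / 16 * p ^ 2 + B ^ 2 * ψ ^ 2 / m * D ^ 2 := by
      have : m / 16 * p ^ 2 + B ^ 2 * ψ ^ 2 / m * D ^ 2 - B / 2 * (ψ * p * D) =
          (m * p / 4 - B * ψ * D) ^ 2 / m := by field_simp; ring
      have h0 : 0 ≤ (m * p / 4 - B * ψ * D) ^ 2 / m := by positivity
      linarith
    have v : B ^ 2 * ψ ^ 2 / m * D ^ 2 ≤ (B ^ 2 * H ^ 2 / m) * Dbar := by
      gcongr B ^ 2 * ?_ / m * ?_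
      exact hsq _ hψ
    linarith
  have t3 : -(q * (h * y * p)) ≤
      (1 / 16) * (a * p ^ 2) + 4 * H ^ 2 * Q / m * (q * y ^ 2) := by
    have u : -(q * (h * y * p)) ≤
        m / 16 * p ^ 2 + 4 * (h ^ 2 * q ^ 2 * y ^ 2) / m := by
      have : m / 16 * p ^ 2 + 4 * (h ^ 2 * q ^ 2 * y ^ 2) / m
          + (q * (h * y * p)) =
          (m * p / 4 + 2 * (h * q * y)) ^ 2 / m := by field_simp; ring
      have h0 : 0 ≤ (m * p / 4 + 2 * (h * q * y)) ^ 2 / m := by positivity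
      linarith
    have v : 4 * (h ^ 2 * q ^ 2 * y ^ 2) / m ≤ 4 * H ^ 2 * Q / m * (q * y ^ 2) := by
      have hqq : q ^ 2 ≤ Q * q := by nlinarith
      have : h ^ 2 * q ^ 2 * y ^ 2 ≤ H ^ 2 * (Q * q) * y ^ 2 := by
        gcongr ?_ * ?_ * _
        exact hsq _ hh
      calc 4 * (h ^ 2 * q ^ 2 * y ^ 2) / m ≤ 4 * (H ^ 2 * (Q * q) * y ^ 2) / m := by
            gcongr
        _ = _ := by ring
    linarith
  nlinarith [t1, t2, t3]

/-- The two multipliers together control the energy density up to the damping. -/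
theorem AdaptedWeights.exists_decay_estimate {a q h h' ψ ψ' : ℝ → ℝ} {B K H m k Q : ℝ}
    (W : AdaptedWeights a q h h' ψ ψ' B K H m k Q) :
    ∃ C, 0 ≤ C ∧ ∀ {y p yt pt : ℝ → ℝ}, WaveSlice a q y p yt pt → ∀ s r : ℝ,
      (∫ x in (0:ℝ)..1, h x * (yt x * p x + y x * pt x)) -
        B / 2 * (∫ x in (0:ℝ)..1, ψ x * (pt x * ((∫ z in (0:ℝ)..x, y z) + s) +
          p x * (a x * p x - ((∫ z in (0:ℝ)..x, q z * y z) + r)))) ≤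
      -(1 / 4) * (∫ x in (0:ℝ)..1, (y x ^ 2 + a x * p x ^ 2)) +
        C * ((∫ x in (0:ℝ)..1, q x * y x ^ 2) + s ^ 2 + r ^ 2) := by
  have hm := W.m_pos
  have hk := W.k_pos
  have hB := W.B_nonneg
  have hH := W.H_nonneg
  have hQ := W.Q_nonneg
  set c1 := B * H / k + B ^ 2 * H ^ 2 / k + 4 * H ^ 2 * Q / m with hc1
  set c2 := B ^ 2 * H ^ 2 / m with hc2
  have hc1' : 0 ≤ c1 := by positivity
  have hc2' : 0 ≤ c2 := by positivity
  refine ⟨c1 + 2 * c2 * (Q + 1) + 1, by positivity, ?_⟩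
  intro y p yt pt S s r
  have h01 : (1:ℝ) ∈ Icc (0:ℝ) 1 := by simp
  have ha := S.a_cont
  have hy := S.y_cont
  have hp := S.p_cont
  have hψc := W.ψ_cont
  have hhc := W.h_cont
  have hψ'c := W.ψ'_cont
  set Y : ℝ → ℝ := fun x => (∫ z in (0:ℝ)..x, y z) + s with hYdef
  set D : ℝ → ℝ := fun x => (∫ z in (0:ℝ)..x, q z * y z) + r with hDdef
  have hYc : ContinuousOn Y (Icc 0 1) := by
    have := intervalIntegral.continuousOn_primitive_interval (a := 0) (b := 1) (μ := volume)
      (f := y) (by rw [uIcc_of_le zero_le_one]; exact hy.integrableOn_Icc)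
    rw [uIcc_of_le zero_le_one] at this
    exact this.add continuousOn_const
  have hDc : ContinuousOn D (Icc 0 1) := by
    have := intervalIntegral.continuousOn_primitive_interval (a := 0) (b := 1) (μ := volume)
      (f := fun z => q z * y z) (by
        rw [uIcc_of_le zero_le_one, integrableOn_Icc_iff_integrableOn_Ioc]
        exact (intervalIntegrable_iff_integrableOn_Ioc_of_le zero_le_one).1
          (S.intervalIntegrable_q_mul h01 hy))
    rw [uIcc_of_le zero_le_one] at this
    exact this.add continuousOn_const
  have hYd : ∀ x ∈ Ioo (0:ℝ) 1, HasDerivAt Y (y x) x := fun x hx => by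
    have hnh : Icc (0:ℝ) 1 ∈ 𝓝 x := Icc_mem_nhds hx.1 hx.2
    refine (intervalIntegral.integral_hasDerivAt_right
      (intervalIntegrable_of_continuousOn_Icc (Ioo_subset_Icc_self hx) hy) ?_
      (hy.continuousAt hnh)).add_const s
    exact (hy.mono Ioo_subset_Icc_self).stronglyMeasurableAtFilter isOpen_Ioo x hx
  have e1 := S.multiplier_estimate (fun x hx => hm.le.trans (W.a_ge x hx)) W.deriv_a W.K_nonneg
    W.h_zero W.h_one W.h_deriv W.h'_cont hψc W.growth
  have e2 := S.localized_identity W.ψ_deriv hψ'c W.ψ_zero W.ψ_one hYc hYd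
    (Yt := fun x => a x * p x - D x) (by fun_prop)
  change _ - B / 2 * (∫ x in (0:ℝ)..1, ψ x * (pt x * Y x + p x * (a x * p x - D x))) ≤ _
  rw [e2]
  set Sy := ∫ x in (0:ℝ)..1, y x ^ 2 with hSy
  set Sp := ∫ x in (0:ℝ)..1, a x * p x ^ 2 with hSp
  set Qy := ∫ x in (0:ℝ)..1, q x * y x ^ 2 with hQy
  have iy : IntervalIntegrable (fun x => y x ^ 2) volume 0 1 :=
    intervalIntegrable_of_continuousOn_Icc h01 (by fun_prop)
  have ip : IntervalIntegrable (fun x => a x * p x ^ 2) volume 0 1 :=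
    intervalIntegrable_of_continuousOn_Icc h01 (by fun_prop)
  have iq : IntervalIntegrable (fun x => q x * y x ^ 2) volume 0 1 :=
    S.intervalIntegrable_q_mul h01 (by fun_prop)
  have hS : ∫ x in (0:ℝ)..1, (y x ^ 2 + a x * p x ^ 2) = Sy + Sp :=
    intervalIntegral.integral_add iy ip
  have i1 : IntervalIntegrable (fun x => -(1 / 2) * (1 - B * ψ x) * (y x ^ 2 + a x * p x ^ 2)
      - q x * (h x * y x * p x)) volume 0 1 :=
    (intervalIntegrable_of_continuousOn_Icc h01 (by fun_prop)).sub
      (S.intervalIntegrable_q_mul h01 (by fun_prop))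
  have i2 : IntervalIntegrable (fun x => ψ x * p x * (a x * p x - D x) - ψ' x * y x * Y x
      - ψ x * y x ^ 2) volume 0 1 :=
    intervalIntegrable_of_continuousOn_Icc h01 (by fun_prop)
  have key := integral_mono_of_ae_Ioo (i1.sub (i2.const_mul (B / 2)))
    (g := fun x => -(1 / 2) * y x ^ 2 + -(3 / 8) * (a x * p x ^ 2) + c1 * (q x * y x ^ 2)
      + ((1 / 16) * (2 * Sy + 2 * s ^ 2) + c2 * (2 * Q * Qy + 2 * r ^ 2)))
    ((((iy.const_mul _).add (ip.const_mul _)).add (iq.const_mul _)).add (by simp)) ?_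
  · rw [intervalIntegral.integral_sub i1 (i2.const_mul _),
      intervalIntegral.integral_add (((iy.const_mul _).add (ip.const_mul _)).add (iq.const_mul _))
        (by simp),
      intervalIntegral.integral_add ((iy.const_mul _).add (ip.const_mul _)) (iq.const_mul _),
      intervalIntegral.integral_add (iy.const_mul _) (ip.const_mul _)] at key
    simp only [intervalIntegral.integral_const_mul, intervalIntegral.integral_const, sub_zero,
      one_smul] at key
    rw [hS]
    have hSy0 : 0 ≤ Sy := intervalIntegral.integral_nonneg zero_le_one fun x _ => sq_nonneg _
    have hSp0 : 0 ≤ Sp := intervalIntegral.integral_nonneg zero_le_one fun x hx => by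
      have := hm.le.trans (W.a_ge x hx); positivity
    have hQy0 : 0 ≤ Qy := by
      have := integral_mono_of_ae_Ioo (f := fun _ => (0:ℝ)) (by simp) iq (by
        filter_upwards [W.q_bound] with x hx
        have := hx.1; positivity)
      simpa using this
    have n1 : 0 ≤ c1 * s ^ 2 := by positivity
    have n2 : 0 ≤ c1 * r ^ 2 := by positivity
    have n3 : 0 ≤ c2 * (Q + 1) * s ^ 2 := by positivity
    have n4 : 0 ≤ c2 * Q * r ^ 2 := by positivity
    have n5 : 0 ≤ c2 * Qy := by positivity
    nlinarith [e1, key, sq_nonneg s, sq_nonneg r]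
  · filter_upwards [W.supp, W.q_bound, ae_restrict_mem measurableSet_Ioo] with x hsupp hq hx
    have hxI := Ioo_subset_Icc_self hx
    have bY : Y x ^ 2 ≤ 2 * Sy + 2 * s ^ 2 := sq_primitive_le hy s hxI
    have bD : D x ^ 2 ≤ 2 * Q * Qy + 2 * r ^ 2 :=
      sq_damped_primitive_le S.q_int W.q_bound hy r hxI
    have ba := W.a_ge x hxI
    exact pointwise_decay_estimate hm hk hB hH ba (W.h_le x hxI) (W.ψ_le x hxI) (W.ψ'_le x hxI)
      hsupp hq.1 hq.2 bY bD

/-- The functional built from the two multipliers is bounded by the energy. -/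
theorem AdaptedWeights.exists_functional_bound {a q h h' ψ ψ' : ℝ → ℝ} {B K H m k Q : ℝ}
    (W : AdaptedWeights a q h h' ψ ψ' B K H m k Q) :
    ∃ C, 0 ≤ C ∧ ∀ {y p : ℝ → ℝ}, ContinuousOn y (Icc 0 1) → ContinuousOn p (Icc 0 1) → ∀ s : ℝ,
      |(∫ x in (0:ℝ)..1, h x * (y x * p x)) -
        B / 2 * (∫ x in (0:ℝ)..1, ψ x * (p x * ((∫ z in (0:ℝ)..x, y z) + s)))| ≤
      C * ((∫ x in (0:ℝ)..1, (y x ^ 2 + a x * p x ^ 2)) + s ^ 2) := by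
  have hm := W.m_pos
  have hB := W.B_nonneg
  have hH := W.H_nonneg
  set c := H / 2 + B * H / 4 with hc
  have hc0 : 0 ≤ c := by positivity
  refine ⟨c * (3 + 1 / m), by positivity, ?_⟩
  intro y p hy hp s
  have h01 : (1:ℝ) ∈ Icc (0:ℝ) 1 := by simp
  have ha := W.a_cont
  have hψc := W.ψ_cont
  have hhc := W.h_cont
  set Y : ℝ → ℝ := fun x => (∫ z in (0:ℝ)..x, y z) + s with hYdef
  have hYc : ContinuousOn Y (Icc 0 1) := by
    have := intervalIntegral.continuousOn_primitive_interval (a := 0) (b := 1) (μ := volume)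
      (f := y) (by rw [uIcc_of_le zero_le_one]; exact hy.integrableOn_Icc)
    rw [uIcc_of_le zero_le_one] at this
    exact this.add continuousOn_const
  set Sy := ∫ x in (0:ℝ)..1, y x ^ 2 with hSy
  set Sp := ∫ x in (0:ℝ)..1, a x * p x ^ 2 with hSp
  have iy : IntervalIntegrable (fun x => y x ^ 2) volume 0 1 :=
    intervalIntegrable_of_continuousOn_Icc h01 (by fun_prop)
  have ip : IntervalIntegrable (fun x => a x * p x ^ 2) volume 0 1 :=
    intervalIntegrable_of_continuousOn_Icc h01 (by fun_prop)
  have i1 : IntervalIntegrable (fun x => h x * (y x * p x)) volume 0 1 :=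
    intervalIntegrable_of_continuousOn_Icc h01 (by fun_prop)
  have i2 : IntervalIntegrable (fun x => ψ x * (p x * Y x)) volume 0 1 :=
    intervalIntegrable_of_continuousOn_Icc h01 (by fun_prop)
  rw [intervalIntegral.integral_add iy ip]
  change |_ - B / 2 * (∫ x in (0:ℝ)..1, ψ x * (p x * Y x))| ≤ _
  rw [← intervalIntegral.integral_const_mul, ← intervalIntegral.integral_sub i1
    (i2.const_mul (B / 2))]
  refine (intervalIntegral.abs_integral_le_integral_abs zero_le_one).trans ?_
  refine (integral_mono_of_ae_Ioo (i1.sub (i2.const_mul _)).abs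
    (g := fun x => c * y x ^ 2 + c / m * (a x * p x ^ 2) + c * (2 * Sy + 2 * s ^ 2))
    (((iy.const_mul _).add (ip.const_mul _)).add (by simp)) ?_).trans ?_
  · filter_upwards [ae_restrict_mem measurableSet_Ioo] with x hx
    have hxI := Ioo_subset_Icc_self hx
    have bY : Y x ^ 2 ≤ 2 * Sy + 2 * s ^ 2 := sq_primitive_le hy s hxI
    have u1 : |h x * (y x * p x)| ≤ H / 2 * (y x ^ 2 + p x ^ 2) := by
      rw [abs_mul]
      have : |y x * p x| ≤ 1 / 2 * (y x ^ 2 + p x ^ 2) :=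
        abs_le.2 ⟨by nlinarith [sq_nonneg (y x + p x)], by nlinarith [sq_nonneg (y x - p x)]⟩
      calc |h x| * |y x * p x| ≤ H * (1 / 2 * (y x ^ 2 + p x ^ 2)) :=
            mul_le_mul (W.h_le x hxI) this (abs_nonneg _) hH
        _ = _ := by ring
    have u2 : |B / 2 * (ψ x * (p x * Y x))| ≤ B * H / 4 * (p x ^ 2 + Y x ^ 2) := by
      rw [abs_mul, abs_mul (ψ x), abs_of_nonneg (by positivity : 0 ≤ B / 2)]
      have : |p x * Y x| ≤ 1 / 2 * (p x ^ 2 + Y x ^ 2) :=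
        abs_le.2 ⟨by nlinarith [sq_nonneg (p x + Y x)], by nlinarith [sq_nonneg (p x - Y x)]⟩
      calc B / 2 * (|ψ x| * |p x * Y x|) ≤ B / 2 * (H * (1 / 2 * (p x ^ 2 + Y x ^ 2))) := by
            gcongr; exact W.ψ_le x hxI
        _ = _ := by ring
    have u3 : c * p x ^ 2 ≤ c / m * (a x * p x ^ 2) := by
      calc c * p x ^ 2 = c / m * (m * p x ^ 2) := by field_simp
        _ ≤ _ := by gcongr; exact W.a_ge x hxI
    have u4 := mul_le_mul_of_nonneg_left bY hc0
    refine (abs_sub _ _).trans ?_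
    have n1 : 0 ≤ H / 2 * Y x ^ 2 := by positivity
    have n2 : 0 ≤ B * H / 4 * y x ^ 2 := by positivity
    have : c * (y x ^ 2 + p x ^ 2 + Y x ^ 2) = H / 2 * (y x ^ 2 + p x ^ 2) +
      B * H / 4 * (p x ^ 2 + Y x ^ 2) + H / 2 * Y x ^ 2 + B * H / 4 * y x ^ 2 := by
        rw [hc]; ring
    linarith
  · rw [intervalIntegral.integral_add ((iy.const_mul _).add (ip.const_mul _)) (by simp),
      intervalIntegral.integral_add (iy.const_mul _) (ip.const_mul _)]
    simp only [intervalIntegral.integral_const_mul, intervalIntegral.integral_const, sub_zero,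
      one_smul]
    have hSy0 : 0 ≤ Sy := intervalIntegral.integral_nonneg zero_le_one fun x _ => sq_nonneg _
    have hSp0 : 0 ≤ Sp := intervalIntegral.integral_nonneg zero_le_one fun x hx => by
      have := hm.le.trans (W.a_ge x hx); positivity
    have n1 : 0 ≤ c * Sp := by positivity
    have n2 : 0 ≤ c / m * Sy := by positivity
    have n3 : 0 ≤ c / m * s ^ 2 := by positivity
    have n4 : 0 ≤ c * s ^ 2 := by positivity
    have : c * (3 + 1 / m) * (Sy + Sp + s ^ 2) = 3 * (c * Sy) + 3 * (c * Sp) + 3 * (c * s ^ 2)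
      + c / m * Sy + c / m * Sp + c / m * s ^ 2 := by ring
    linarith

end Estimates

section Lyapunov

/-- Exponential decay from a Lyapunov functional `E` and a bounded perturbation `P` of it. -/
theorem exists_decay_of_perturbed_energy {κ C K : ℝ} (hκ : 0 < κ) (hC : 0 ≤ C) (hK : 0 ≤ K) :
    ∃ M > (0:ℝ), ∃ ν > (0:ℝ), ∀ E P R P' : ℝ → ℝ, ContinuousOn E (Ici 0) →
      ContinuousOn P (Ici 0) → (∀ t, 0 < t → HasDerivAt E (-R t) t) →
      (∀ t, 0 < t → HasDerivAt P (P' t) t) → (∀ t, 0 < t → 0 ≤ R t) → (∀ t, 0 ≤ t → 0 ≤ E t) →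
      (∀ t, 0 < t → P' t ≤ -κ * E t + C * R t) → (∀ t, 0 ≤ t → |P t| ≤ K * E t) →
      ∀ t, 0 ≤ t → E t ≤ M * E 0 * Real.exp (-ν * t) := by
  refine ⟨C + K + 1 + K, by positivity, κ / (C + K + 1 + K), by positivity, ?_⟩
  intro E P R P' hE hP hEd hPd hR hE0 hP' hPK t ht
  have hN : 0 < C + K + 1 + K := by positivity
  have h := le_mul_exp_of_hasDerivAt_le (V := fun s => (C + K + 1) * E s + P s)
    (V' := fun s => (C + K + 1) * (-R s) + P' s) (ν := κ / (C + K + 1 + K))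
    ((continuousOn_const.mul hE).add hP) (fun s hs => ((hEd s hs).const_mul _).add (hPd s hs))
    ?_ ht
  · have h1 := abs_le.1 (hPK t ht)
    have h2 := abs_le.1 (hPK 0 le_rfl)
    have h3 : (C + K + 1) * E 0 + P 0 ≤ (C + K + 1 + K) * E 0 := by linarith
    have h4 := mul_le_mul_of_nonneg_right h3
      (Real.exp_pos (-(κ / (C + K + 1 + K)) * t)).le
    have h5 : 0 ≤ C * E t := mul_nonneg hC (hE0 t ht)
    linarith
  · intro s hs
    have h1 := abs_le.1 (hPK s hs.le)
    have h2 := hP' s hs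
    have h3 : 0 ≤ K * R s := mul_nonneg hK (hR s hs)
    have h4 := hR s hs
    have h5 : κ / (C + K + 1 + K) * ((C + K + 1) * E s + P s) ≤ κ * E s := by
      calc κ / (C + K + 1 + K) * ((C + K + 1) * E s + P s) ≤
          κ / (C + K + 1 + K) * ((C + K + 1 + K) * E s) := by
            gcongr; linarith
        _ = κ * E s := by field_simp
    linarith

theorem exists_boundary_absorption {α₁ α₂ b σ ρ e₁ e₂ e₃ A Z C Q : ℝ} (hα₂ : 0 < α₂)
    (he₁ : 0 < e₁) (he₂ : 0 < e₂) (he₃ : 0 < e₃) (hA : 0 < A) (hZ : 0 < Z) (hC : 0 ≤ C)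
    (hQ : 0 ≤ Q) :
    ∃ κ > 0, ∃ C' ≥ 0, ∀ S N x y z Y D : ℝ, 0 ≤ S → 0 ≤ N → Y ^ 2 ≤ 2 * S + 2 * (σ * z) ^ 2 →
      D ^ 2 ≤ 2 * Q * N + 2 * (ρ * z) ^ 2 →
      -(1 / 4) * S + C * (N + (σ * z) ^ 2 + (ρ * z) ^ 2) +
        (x * (x + b * Y) + y * (-α₁ * x - α₂ * y - b * D)) ≤
      -κ * (1 / 2 * S + e₁ * x ^ 2 + e₂ * y ^ 2 + e₃ * z ^ 2) +
        C' * (N + A * x ^ 2 + Z * z ^ 2) := by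
  have hκ : 0 < min (1 / 4) (α₂ / (2 * e₂)) := lt_min (by norm_num) (by positivity)
  have hκ1 : min (1 / 4) (α₂ / (2 * e₂)) ≤ 1 / 4 := min_le_left _ _
  have hκ2 : min (1 / 4) (α₂ / (2 * e₂)) * e₂ ≤ α₂ / 2 := by
    calc min (1 / 4) (α₂ / (2 * e₂)) * e₂ ≤ α₂ / (2 * e₂) * e₂ := by
          gcongr; exact min_le_right _ _
      _ = α₂ / 2 := by field_simp
  generalize min (1 / 4) (α₂ / (2 * e₂)) = κ at *
  set k₁ := C + 2 * b ^ 2 * Q / α₂ with hk₁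
  set k₂ := 1 + 4 * b ^ 2 + α₁ ^ 2 / α₂ + e₁ with hk₂
  set k₃ := C * σ ^ 2 + C * ρ ^ 2 + σ ^ 2 / 8 + 2 * b ^ 2 * ρ ^ 2 / α₂ + e₃ with hk₃
  have p₁ : 0 ≤ k₁ := by positivity
  have p₂ : 0 ≤ k₂ := by positivity
  have p₃ : 0 ≤ k₃ := by positivity
  refine ⟨κ, hκ, k₁ + k₂ / A + k₃ / Z, by positivity, ?_⟩
  intro S N x y z Y D hS hN hY hD
  have f₁ : x * (b * Y) ≤ Y ^ 2 / 16 + 4 * b ^ 2 * x ^ 2 := by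
    nlinarith [sq_nonneg (Y / 4 - 2 * b * x)]
  have f₂ : -α₁ * x * y ≤ α₂ / 4 * y ^ 2 + α₁ ^ 2 / α₂ * x ^ 2 := by
    have : α₂ / 4 * y ^ 2 + α₁ ^ 2 / α₂ * x ^ 2 + α₁ * x * y = (α₂ * y / 2 + α₁ * x) ^ 2 / α₂ := by
      field_simp; ring
    have h0 : 0 ≤ (α₂ * y / 2 + α₁ * x) ^ 2 / α₂ := by positivity
    linarith
  have f₃ : -(b * D) * y ≤ α₂ / 4 * y ^ 2 + b ^ 2 / α₂ * D ^ 2 := by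
    have : α₂ / 4 * y ^ 2 + b ^ 2 / α₂ * D ^ 2 + b * D * y = (α₂ * y / 2 + b * D) ^ 2 / α₂ := by
      field_simp; ring
    have h0 : 0 ≤ (α₂ * y / 2 + b * D) ^ 2 / α₂ := by positivity
    linarith
  have f₄ : b ^ 2 / α₂ * D ^ 2 ≤
      2 * b ^ 2 * Q / α₂ * N + 2 * b ^ 2 * ρ ^ 2 / α₂ * z ^ 2 := by
    calc b ^ 2 / α₂ * D ^ 2 ≤ b ^ 2 / α₂ * (2 * Q * N + 2 * (ρ * z) ^ 2) := by gcongr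
      _ = _ := by ring
  have g₁ : k₁ * N + k₂ * x ^ 2 + k₃ * z ^ 2 ≤
      (k₁ + k₂ / A + k₃ / Z) * (N + A * x ^ 2 + Z * z ^ 2) := by
    have : (k₁ + k₂ / A + k₃ / Z) * (N + A * x ^ 2 + Z * z ^ 2) =
        k₁ * N + k₂ * x ^ 2 + k₃ * z ^ 2 + (k₁ * (A * x ^ 2 + Z * z ^ 2)
          + k₂ / A * (N + Z * z ^ 2) + k₃ / Z * (N + A * x ^ 2)) := by field_simp; ring
    have h0 : 0 ≤ k₁ * (A * x ^ 2 + Z * z ^ 2)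
          + k₂ / A * (N + Z * z ^ 2) + k₃ / Z * (N + A * x ^ 2) := by positivity
    linarith
  have g₂ : κ * (1 / 2 * S + e₁ * x ^ 2 + e₂ * y ^ 2 + e₃ * z ^ 2) ≤
      S / 8 + e₁ * x ^ 2 + α₂ / 2 * y ^ 2 + e₃ * z ^ 2 := by
    have q₁ : κ * S ≤ 1 / 4 * S := by gcongr
    have q₂ : κ * (e₁ * x ^ 2) ≤ 1 * (e₁ * x ^ 2) := by gcongr; linarith
    have q₃ : κ * e₂ * y ^ 2 ≤ α₂ / 2 * y ^ 2 := by gcongr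
    have q₄ : κ * (e₃ * z ^ 2) ≤ 1 * (e₃ * z ^ 2) := by gcongr; linarith
    linarith
  have g₃ : k₁ * N + k₂ * x ^ 2 + k₃ * z ^ 2 = C * N + 2 * b ^ 2 * Q / α₂ * N + x ^ 2 +
      4 * b ^ 2 * x ^ 2 + α₁ ^ 2 / α₂ * x ^ 2 + e₁ * x ^ 2 + C * (σ * z) ^ 2 + C * (ρ * z) ^ 2
      + (σ * z) ^ 2 / 8 + 2 * b ^ 2 * ρ ^ 2 / α₂ * z ^ 2 + e₃ * z ^ 2 := by
    rw [hk₁, hk₂, hk₃]; ring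
  linarith

theorem exists_boundary_functional_bound {b σ e₁ e₂ e₃ C : ℝ} (he₁ : 0 < e₁) (he₂ : 0 < e₂)
    (he₃ : 0 < e₃) (hC : 0 ≤ C) :
    ∃ K ≥ 0, ∀ S T x y z Y : ℝ, 0 ≤ S → Y ^ 2 ≤ 2 * S + 2 * (σ * z) ^ 2 →
      |T| ≤ C * (S + (σ * z) ^ 2) →
      |T + y * (x + b * Y)| ≤ K * (1 / 2 * S + e₁ * x ^ 2 + e₂ * y ^ 2 + e₃ * z ^ 2) := by
  set k₁ := 2 * C + 4 * b ^ 2 with hk₁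
  set k₃ := C * σ ^ 2 + 2 * b ^ 2 * σ ^ 2 with hk₃
  have p₁ : 0 ≤ k₁ := by positivity
  have p₃ : 0 ≤ k₃ := by positivity
  refine ⟨k₁ + 1 / e₁ + 1 / e₂ + k₃ / e₃, by positivity, ?_⟩
  intro S T x y z Y hS hY hT
  have f₁ : |y * (x + b * Y)| ≤ y ^ 2 + x ^ 2 + b ^ 2 * Y ^ 2 :=
    abs_le.2 ⟨by nlinarith [sq_nonneg (y + (x + b * Y)), sq_nonneg (x - b * Y)],
      by nlinarith [sq_nonneg (y - (x + b * Y)), sq_nonneg (x - b * Y)]⟩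
  have f₂ : b ^ 2 * Y ^ 2 ≤ b ^ 2 * (2 * S + 2 * (σ * z) ^ 2) := by gcongr
  have g : k₁ * (1 / 2 * S) + x ^ 2 + y ^ 2 + k₃ * z ^ 2 ≤ (k₁ + 1 / e₁ + 1 / e₂ + k₃ / e₃) *
      (1 / 2 * S + e₁ * x ^ 2 + e₂ * y ^ 2 + e₃ * z ^ 2) := by
    have : (k₁ + 1 / e₁ + 1 / e₂ + k₃ / e₃) *
      (1 / 2 * S + e₁ * x ^ 2 + e₂ * y ^ 2 + e₃ * z ^ 2) =
        k₁ * (1 / 2 * S) + x ^ 2 + y ^ 2 + k₃ * z ^ 2 +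
        (k₁ * (e₁ * x ^ 2 + e₂ * y ^ 2 + e₃ * z ^ 2)
          + 1 / e₁ * (1 / 2 * S + e₂ * y ^ 2 + e₃ * z ^ 2)
          + 1 / e₂ * (1 / 2 * S + e₁ * x ^ 2 + e₃ * z ^ 2)
          + k₃ / e₃ * (1 / 2 * S + e₁ * x ^ 2 + e₂ * y ^ 2)) := by field_simp; ring
    have h0 : 0 ≤ (k₁ * (e₁ * x ^ 2 + e₂ * y ^ 2 + e₃ * z ^ 2)
          + 1 / e₁ * (1 / 2 * S + e₂ * y ^ 2 + e₃ * z ^ 2)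
          + 1 / e₂ * (1 / 2 * S + e₁ * x ^ 2 + e₃ * z ^ 2)
          + k₃ / e₃ * (1 / 2 * S + e₁ * x ^ 2 + e₂ * y ^ 2)) := by positivity
    linarith
  have g₂ : k₁ * (1 / 2 * S) + x ^ 2 + y ^ 2 + k₃ * z ^ 2 =
      C * (S + (σ * z) ^ 2) + (y ^ 2 + x ^ 2) + b ^ 2 * (2 * S + 2 * (σ * z) ^ 2) := by
    rw [hk₁, hk₃]; ring
  refine (abs_add_le _ _).trans ?_
  linarith

end Lyapunov

section Solution

/-- A `C¹` function on a strip has a continuous partial derivative in its first variable. -/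
theorem ContDiffOn.exists_partial_deriv {f : ℝ → ℝ → ℝ}
    (hf : ContDiffOn ℝ 1 (fun z : ℝ × ℝ => f z.1 z.2) (Ici (0:ℝ) ×ˢ Icc (0:ℝ) 1)) :
    ∃ f' : ℝ → ℝ → ℝ,
      ContinuousOn (fun z : ℝ × ℝ => f' z.1 z.2) (Ici (0:ℝ) ×ˢ Icc (0:ℝ) 1) ∧
      ∀ t, 0 < t → ∀ x ∈ Icc (0:ℝ) 1, HasDerivAt (fun s => f s x) (f' t x) t := by
  have hu : UniqueDiffOn ℝ (Ici (0:ℝ) ×ˢ Icc (0:ℝ) 1) :=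
    (uniqueDiffOn_Ici 0).prod (uniqueDiffOn_Icc zero_lt_one)
  refine ⟨fun t x => fderivWithin ℝ (fun z : ℝ × ℝ => f z.1 z.2) (Ici (0:ℝ) ×ˢ Icc (0:ℝ) 1)
    (t, x) (1, 0), (hf.continuousOn_fderivWithin hu le_rfl).clm_apply continuousOn_const, ?_⟩
  intro t ht x hx
  have h := ((hf.differentiableOn one_ne_zero) (t, x) ⟨ht.le, hx⟩).hasFDerivWithinAt
  have hc : HasDerivWithinAt (fun s : ℝ => (s, x)) ((1:ℝ), (0:ℝ)) (Ici 0) t :=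
    ((hasDerivAt_id t).prodMk (hasDerivAt_const t x)).hasDerivWithinAt
  have hmaps : MapsTo (fun s : ℝ => (s, x)) (Ici 0) (Ici (0:ℝ) ×ˢ Icc (0:ℝ) 1) :=
    fun s hs => ⟨hs, hx⟩
  exact (h.comp_hasDerivWithinAt t hc hmaps).hasDerivAt (Ici_mem_nhds ht)

theorem ContDiffOn.absolutelyContinuous_slice {f : ℝ → ℝ → ℝ}
    (hf : ContDiffOn ℝ 1 (fun z : ℝ × ℝ => f z.1 z.2) (Ici (0:ℝ) ×ˢ Icc (0:ℝ) 1))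
    {t : ℝ} (ht : 0 ≤ t) : AbsolutelyContinuousOnInterval (f t) 0 1 := by
  have : ContDiffOn ℝ 1 (f t) (Icc 0 1) :=
    hf.comp (f := fun x : ℝ => (t, x)) (by fun_prop) fun x hx => ⟨ht, hx⟩
  exact ContDiffOn.absolutelyContinuousOnInterval (by rwa [uIcc_of_le zero_le_one])

namespace ClassicalSolutionS

variable {a q : ℝ → ℝ} {α₁ α₂ β₁ γ₁ μ₁ : ℝ} (sol : ClassicalSolutionS a q α₁ α₂ β₁ γ₁ μ₁)

theorem integral_ux {t x : ℝ} (ht : 0 ≤ t) (hx : x ∈ Icc (0:ℝ) 1) :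
    ∫ s in (0:ℝ)..x, sol.ux t s = sol.u t x - sol.u t 0 := by
  refine intervalIntegral.integral_eq_sub_of_hasDerivAt (fun s hs => ?_)
    (intervalIntegrable_of_continuousOn_Icc hx (continuousOn_slice sol.hux_C1.continuousOn ht))
  rw [uIcc_of_le hx.1] at hs
  exact sol.hu_x t ht s ⟨hs.1, hs.2.trans hx.2⟩

theorem hasDerivAt_ut {pt : ℝ → ℝ → ℝ}
    (hc : ContinuousOn (fun z : ℝ × ℝ => pt z.1 z.2) (Ici (0:ℝ) ×ˢ Icc (0:ℝ) 1))
    (hd : ∀ t, 0 < t → ∀ x ∈ Icc (0:ℝ) 1, HasDerivAt (fun s => sol.ux s x) (pt t x) t)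
    {t x : ℝ} (ht : 0 < t) (hx : x ∈ Ioo (0:ℝ) 1) : HasDerivAt (sol.ut t) (pt t x) x := by
  have h0 : (0:ℝ) ∈ Icc (0:ℝ) 1 := by simp
  have key : ∀ z ∈ Icc (0:ℝ) 1, sol.ut t z = (∫ s in (0:ℝ)..z, pt t s) + sol.ut t 0 := by
    intro z hz
    have h1 := hasDerivAt_integral_strip hz ht sol.hux_C1.continuousOn hc hd
    have h2 := (sol.hu_t t ht.le z hz).sub (sol.hu_t t ht.le 0 h0)
    have h3 := h1.unique (h2.congr_of_eventuallyEq (by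
      filter_upwards [lt_mem_nhds ht] with s hs using sol.integral_ux hs.le hz))
    linarith
  have hslice := continuousOn_slice hc (mem_Ici.2 ht.le)
  have hnh : Icc (0:ℝ) 1 ∈ 𝓝 x := Icc_mem_nhds hx.1 hx.2
  have h := (intervalIntegral.integral_hasDerivAt_right
    (intervalIntegrable_of_continuousOn_Icc (Ioo_subset_Icc_self hx) hslice)
    ((hslice.mono Ioo_subset_Icc_self).stronglyMeasurableAtFilter isOpen_Ioo x hx)
    (hslice.continuousAt hnh)).add_const (sol.ut t 0)
  refine h.congr_of_eventuallyEq ?_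
  filter_upwards [hnh] with z hz using key z hz

theorem waveSlice (ha : AbsolutelyContinuousOnInterval a 0 1)
    (hq : IntervalIntegrable q volume 0 1) {yt pt : ℝ → ℝ → ℝ}
    (hyc : ContinuousOn (fun z : ℝ × ℝ => yt z.1 z.2) (Ici (0:ℝ) ×ˢ Icc (0:ℝ) 1))
    (hyd : ∀ t, 0 < t → ∀ x ∈ Icc (0:ℝ) 1, HasDerivAt (fun s => sol.ut s x) (yt t x) t)
    (hpc : ContinuousOn (fun z : ℝ × ℝ => pt z.1 z.2) (Ici (0:ℝ) ×ˢ Icc (0:ℝ) 1))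
    (hpd : ∀ t, 0 < t → ∀ x ∈ Icc (0:ℝ) 1, HasDerivAt (fun s => sol.ux s x) (pt t x) t)
    {t : ℝ} (ht : 0 < t) : WaveSlice a q (sol.ut t) (sol.ux t) (yt t) (pt t) where
  a_ac := ha
  y_ac := sol.hut_C1.absolutelyContinuous_slice ht.le
  p_ac := sol.hux_C1.absolutelyContinuous_slice ht.le
  yt_cont := continuousOn_slice hyc ht.le
  pt_cont := continuousOn_slice hpc ht.le
  y_deriv x hx := sol.hasDerivAt_ut hpc hpd ht hx
  flux_deriv := by
    filter_upwards [sol.haux t ht.le, sol.hPDE t ht.le, ae_restrict_mem measurableSet_Ioo]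
      with x h1 h2 hx
    have hxI := Ioo_subset_Icc_self hx
    have h3 := (sol.hu_tt t ht.le x hxI).unique (hyd t ht x hxI)
    exact h1.congr_deriv (by linarith)
  q_int := hq

theorem displacement_sub_eta {t : ℝ} (ht : 0 ≤ t) :
    sol.u t 1 - sol.η₂ t = sol.u 0 1 - sol.η₂ 0 := by
  have h1 : (1:ℝ) ∈ Icc (0:ℝ) 1 := by simp
  have hd : ∀ s, 0 ≤ s → HasDerivAt (fun r => sol.u r 1 - sol.η₂ r) 0 s := fun s hs =>
    ((sol.hu_t s hs 1 h1).sub (sol.hode2 s hs)).congr_deriv (by rw [sol.hbc1 s hs, sub_self])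
  exact constant_of_has_deriv_right_zero
    (fun s hs => (hd s hs.1).continuousAt.continuousWithinAt)
    (fun s hs => (hd s hs.1).hasDerivWithinAt) t ⟨ht, le_rfl⟩

/-- The elastic energy and `η₂` control the distance to the equilibrium. -/
theorem sq_displacement_le {m : ℝ} (hm : 0 < m) (hac : ContinuousOn a (Icc 0 1))
    (ha : ∀ x ∈ Icc (0:ℝ) 1, m ≤ a x) {t x : ℝ} (ht : 0 ≤ t)
    (hx : x ∈ Icc (0:ℝ) 1) :
    (sol.u t x - (sol.u 0 1 - sol.η₂ 0)) ^ 2 ≤ 3 * sol.η₂ t ^ 2 +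
      6 / m * ∫ x in (0:ℝ)..1, (sol.ut t x ^ 2 + a x * sol.ux t x ^ 2) := by
  have h1 : (1:ℝ) ∈ Icc (0:ℝ) 1 := by simp
  have hp := continuousOn_slice sol.hux_C1.continuousOn (mem_Ici.2 ht)
  have hy := continuousOn_slice sol.hut_C1.continuousOn (mem_Ici.2 ht)
  have ip := intervalIntegrable_of_continuousOn_Icc h1 hp
  have ip2 : IntervalIntegrable (fun s => sol.ux t s ^ 2) volume 0 1 :=
    intervalIntegrable_of_continuousOn_Icc h1 (by fun_prop)
  have b1 := sq_integral_le_integral_sq h1 ip ip2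
  have b2 := sq_integral_le_integral_sq hx ip ip2
  have e : sol.u t x - (sol.u 0 1 - sol.η₂ 0) =
      sol.η₂ t - (∫ s in (0:ℝ)..1, sol.ux t s) + ∫ s in (0:ℝ)..x, sol.ux t s := by
    rw [sol.integral_ux ht h1, sol.integral_ux ht hx, ← sol.displacement_sub_eta ht]; ring
  have hle : ∫ s in (0:ℝ)..1, sol.ux t s ^ 2 ≤
      ∫ s in (0:ℝ)..1, (1 / m) * (sol.ut t s ^ 2 + a s * sol.ux t s ^ 2) := by
    refine integral_mono_of_ae_Ioo ip2
      (intervalIntegrable_of_continuousOn_Icc h1 (by fun_prop)) ?_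
    filter_upwards [ae_restrict_mem measurableSet_Ioo] with s hs
    rw [one_div, ← div_eq_inv_mul, le_div_iff₀ hm]
    nlinarith [ha s (Ioo_subset_Icc_self hs), sq_nonneg (sol.ut t s), sq_nonneg (sol.ux t s)]
  rw [intervalIntegral.integral_const_mul] at hle
  rw [e]
  generalize (∫ s in (0:ℝ)..1, sol.ux t s) = I at *
  generalize (∫ s in (0:ℝ)..x, sol.ux t s) = J at *
  generalize (∫ x in (0:ℝ)..1, (sol.ut t x ^ 2 + a x * sol.ux t x ^ 2)) = S at *
  have : 6 / m * S = 6 * (1 / m * S) := by ring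
  nlinarith [sq_nonneg (sol.η₂ t + I), sq_nonneg (sol.η₂ t - J), sq_nonneg (I + J)]

end ClassicalSolutionS

end Solution

theorem exists_adaptedWeights {a q : ℝ → ℝ} {a_min a_max c d q_min q_max : ℝ}
    (hA1 : AssumptionA1 a a_min a_max) (hA2 : AssumptionA2 q c d q_min q_max) :
    ∃ (h h' ψ ψ' : ℝ → ℝ) (B K H Q : ℝ), AdaptedWeights a q h h' ψ ψ' B K H a_min q_min Q := by
  obtain ⟨⟨L, hL⟩, hm, -, ha⟩ := hA1
  obtain ⟨-, ⟨Q, hQ⟩, hq0, hc, hcd, hd, hk, -, hqω⟩ := hA2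
  have hK : (0:ℝ) ≤ L / a_min := by positivity
  obtain ⟨h, h', ψ, ψ', B, hB, h0, h1, hhd, hh', hψd, hψ', hψ0, hψs, hg⟩ :=
    exists_multiplier hc hcd hd hK
  have hhc : Continuous h := continuous_iff_continuousAt.2 fun x => (hhd x).continuousAt
  have hψc : Continuous ψ := continuous_iff_continuousAt.2 fun x => (hψd x).continuousAt
  obtain ⟨H, hH⟩ := (isCompact_Icc (a := (0:ℝ)) (b := 1)).exists_bound_of_continuousOn
    (f := fun x => |h x| + |ψ x| + |ψ' x|) (by fun_prop)
  have hH' : ∀ x ∈ Icc (0:ℝ) 1, |h x| + |ψ x| + |ψ' x| ≤ H := fun x hx =>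
    (le_abs_self _).trans (hH x hx)
  have h00 : (0:ℝ) ∈ Icc (0:ℝ) 1 := by simp
  refine ⟨h, h', ψ, ψ', B, L / a_min, H, Q, ?_⟩
  exact
  { m_pos := hm
    a_ge := fun x hx => (ha x hx).1
    a_cont := hL.continuousOn
    K_nonneg := hK
    deriv_a := by
      filter_upwards [ae_restrict_mem measurableSet_Ioo] with x hx
      have h2 := norm_deriv_le_of_lipschitzOn (Icc_mem_nhds hx.1 hx.2) hL
      rw [Real.norm_eq_abs] at h2
      refine h2.trans ?_
      rw [div_mul_eq_mul_div, le_div_iff₀ hm]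
      exact mul_le_mul_of_nonneg_left (ha x (Ioo_subset_Icc_self hx)).1 L.2
    B_nonneg := hB
    h_zero := h0
    h_one := h1
    h_deriv := hhd
    h'_cont := hh'
    ψ_zero := (hψs 0 fun hx => hc.not_gt hx.1).1
    ψ_one := (hψs 1 fun hx => hd.not_gt hx.2).1
    ψ_deriv := hψd
    ψ'_cont := hψ'
    ψ_nonneg := hψ0
    growth := hg
    H_nonneg := (by positivity : 0 ≤ |h 0| + |ψ 0| + |ψ' 0|).trans (hH' 0 h00)
    h_le := fun x hx => by linarith [hH' x hx, abs_nonneg (ψ x), abs_nonneg (ψ' x)]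
    ψ_le := fun x hx => by linarith [hH' x hx, abs_nonneg (h x), abs_nonneg (ψ' x)]
    ψ'_le := fun x hx => by linarith [hH' x hx, abs_nonneg (h x), abs_nonneg (ψ x)]
    k_pos := hk
    supp := by
      refine ae_restrict_of_ae ?_
      filter_upwards [(ae_restrict_iff' measurableSet_Ioo).1 hqω] with x hx
      by_cases hxω : x ∈ Ioo c d
      · exact Or.inr (hx hxω).1
      · exact Or.inl (hψs x hxω)
    Q_nonneg := (abs_nonneg (q 0)).trans (hQ 0 h00)
    q_bound := by
      filter_upwards [hq0, ae_restrict_mem measurableSet_Ioo] with x h2 hx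
      exact ⟨h2, (le_abs_self _).trans (hQ x (Ioo_subset_Icc_self hx))⟩ }

theorem AssumptionA2.intervalIntegrable {q : ℝ → ℝ} {c d q_min q_max : ℝ}
    (hA2 : AssumptionA2 q c d q_min q_max) : IntervalIntegrable q volume 0 1 := by
  obtain ⟨hm, ⟨Q, hQ⟩, -⟩ := hA2
  rw [intervalIntegrable_iff_integrableOn_Ioc_of_le zero_le_one]
  refine IntegrableOn.of_bound (by simp) hm.aestronglyMeasurable Q ?_
  filter_upwards [ae_restrict_mem measurableSet_Ioc] with x hx
  exact hQ x (Ioc_subset_Icc_self hx)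

namespace ClassicalSolutionS

variable {a q : ℝ → ℝ} {α₁ α₂ β₁ γ₁ μ₁ : ℝ} (sol : ClassicalSolutionS a q α₁ α₂ β₁ γ₁ μ₁)

/-- The rate of dissipation of the energy. -/
noncomputable def dissipation (t : ℝ) : ℝ :=
  (∫ x in (0:ℝ)..1, q x * sol.ut t x ^ 2) + a 1 * α₁ / β₁ * sol.η₁ t ^ 2 +
    a 0 * γ₁ / μ₁ * sol.ζ₁ t ^ 2

/-- The perturbation of the energy which turns it into a strict Lyapunov functional, for the
weights `h` and `ψ`. -/
noncomputable def perturbation (h ψ : ℝ → ℝ) (B : ℝ) (t : ℝ) : ℝ :=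
  (∫ x in (0:ℝ)..1, h x * (sol.ut t x * sol.ux t x)) -
      B / 2 * (∫ x in (0:ℝ)..1, ψ x * (sol.ux t x *
        ((∫ z in (0:ℝ)..x, sol.ut t z) + a 0 / μ₁ * sol.ζ₁ t))) +
    sol.η₂ t * (sol.η₁ t +
      β₁ / a 1 * ((∫ z in (0:ℝ)..1, sol.ut t z) + a 0 / μ₁ * sol.ζ₁ t))

theorem continuousOn_energyS (ha : ContinuousOn a (Icc 0 1)) :
    ContinuousOn (energyS sol) (Ici 0) := by
  have h1 : ContinuousOn (fun z : ℝ × ℝ => sol.ut z.1 z.2) (Ici (0:ℝ) ×ˢ Icc (0:ℝ) 1) :=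
    sol.hut_C1.continuousOn
  have h2 : ContinuousOn (fun z : ℝ × ℝ => sol.ux z.1 z.2) (Ici (0:ℝ) ×ˢ Icc (0:ℝ) 1) :=
    sol.hux_C1.continuousOn
  have h3 : ContinuousOn (fun z : ℝ × ℝ => a z.2) (Ici (0:ℝ) ×ˢ Icc (0:ℝ) 1) :=
    ha.comp continuousOn_snd fun z hz => hz.2
  have h4 := continuousOn_integral_strip (f := fun t x => sol.ut t x ^ 2 + a x * sol.ux t x ^ 2)
    ((h1.pow 2).add (h3.mul (h2.pow 2)))
  exact (((h4.const_mul _).add ((sol.hη₁C1.continuousOn.pow 2).const_mul _)).add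
    ((sol.hη₂C1.continuousOn.pow 2).const_mul _)).add
    ((sol.hζ₁C1.continuousOn.pow 2).const_mul _)

theorem energyS_nonneg (hα₂ : 0 ≤ α₂) (hβ₁ : 0 ≤ β₁) (hμ₁ : 0 ≤ μ₁)
    (ha : ∀ x ∈ Icc (0:ℝ) 1, 0 ≤ a x) (t : ℝ) : 0 ≤ energyS sol t := by
  have h0 : 0 ≤ a 0 := ha 0 (by simp)
  have h1 : 0 ≤ a 1 := ha 1 (by simp)
  have h2 : 0 ≤ ∫ x in (0:ℝ)..1, (sol.ut t x ^ 2 + a x * sol.ux t x ^ 2) :=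
    intervalIntegral.integral_nonneg zero_le_one fun x hx => by
      have := ha x hx
      positivity
  unfold energyS
  positivity

theorem hasDerivAt_energyS (hβ₁ : β₁ ≠ 0) (hμ₁ : μ₁ ≠ 0)
    (hac : AbsolutelyContinuousOnInterval a 0 1) (hq : IntervalIntegrable q volume 0 1)
    {t : ℝ} (ht : 0 < t) : HasDerivAt (energyS sol) (-sol.dissipation t) t := by
  obtain ⟨yt, hyc, hyd⟩ := sol.hut_C1.exists_partial_deriv
  obtain ⟨pt, hpc, hpd⟩ := sol.hux_C1.exists_partial_deriv
  have S := sol.waveSlice hac hq hyc hyd hpc hpd ht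
  have h1 : ContinuousOn (fun z : ℝ × ℝ => sol.ut z.1 z.2) (Ici (0:ℝ) ×ˢ Icc (0:ℝ) 1) :=
    sol.hut_C1.continuousOn
  have h2 : ContinuousOn (fun z : ℝ × ℝ => sol.ux z.1 z.2) (Ici (0:ℝ) ×ˢ Icc (0:ℝ) 1) :=
    sol.hux_C1.continuousOn
  have h3 : ContinuousOn (fun z : ℝ × ℝ => a z.2) (Ici (0:ℝ) ×ˢ Icc (0:ℝ) 1) :=
    S.a_cont.comp continuousOn_snd fun z hz => hz.2
  have hI := hasDerivAt_integral_strip (b := 1)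
    (f := fun t x => sol.ut t x ^ 2 + a x * sol.ux t x ^ 2)
    (f' := fun t x => 2 * (sol.ut t x * yt t x + a x * sol.ux t x * pt t x)) (by simp) ht
    ((h1.pow 2).add (h3.mul (h2.pow 2)))
    (continuousOn_const.mul ((h1.mul hyc).add ((h3.mul h2).mul hpc)))
    (fun s hs x hx => (((hyd s hs x hx).pow 2).add
      (((hpd s hs x hx).pow 2).const_mul (a x))).congr_deriv (by push_cast; ring))
  rw [intervalIntegral.integral_const_mul, S.energy_identity, sol.hbc1 t ht.le,
    sol.hbc0 t ht.le] at hI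
  refine ((((hI.const_mul (1 / 2)).add (((sol.hode1 t ht.le).pow 2).const_mul _)).add
    (((sol.hode2 t ht.le).pow 2).const_mul _)).add
    (((sol.hode3 t ht.le).pow 2).const_mul _)).congr_deriv ?_
  unfold dissipation
  push_cast
  field_simp
  ring

theorem continuousOn_perturbation {h ψ : ℝ → ℝ} (hh : Continuous h) (hψ : Continuous ψ) (B : ℝ) :
    ContinuousOn (sol.perturbation h ψ B) (Ici 0) := by
  have h1 : ContinuousOn (fun z : ℝ × ℝ => sol.ut z.1 z.2) (Ici (0:ℝ) ×ˢ Icc (0:ℝ) 1) :=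
    sol.hut_C1.continuousOn
  have h2 : ContinuousOn (fun z : ℝ × ℝ => sol.ux z.1 z.2) (Ici (0:ℝ) ×ˢ Icc (0:ℝ) 1) :=
    sol.hux_C1.continuousOn
  have h3 : ContinuousOn (fun z : ℝ × ℝ => sol.ζ₁ z.1) (Ici (0:ℝ) ×ˢ Icc (0:ℝ) 1) :=
    sol.hζ₁C1.continuousOn.comp continuousOn_fst fun z hz => hz.1
  have h4 := (continuousOn_primitive_strip h1).add (h3.const_mul (a 0 / μ₁))
  have h5 := continuousOn_integral_strip
    (f := fun t x => h x * (sol.ut t x * sol.ux t x))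
    ((hh.comp continuous_snd).continuousOn.mul (h1.mul h2))
  have h6 := continuousOn_integral_strip
    (f := fun t x => ψ x * (sol.ux t x * ((∫ z in (0:ℝ)..x, sol.ut t z) + a 0 / μ₁ * sol.ζ₁ t)))
    ((hψ.comp continuous_snd).continuousOn.mul (h2.mul h4))
  exact (h5.sub (h6.const_mul _)).add (sol.hη₂C1.continuousOn.mul (sol.hη₁C1.continuousOn.add
    (((continuousOn_integral_strip h1).add (sol.hζ₁C1.continuousOn.const_mul _)).const_mul _)))

theorem hasDerivAt_perturbation (ha0 : a 0 ≠ 0) (ha1 : a 1 ≠ 0) (hμ₁ : μ₁ ≠ 0)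
    (hac : AbsolutelyContinuousOnInterval a 0 1) (hq : IntervalIntegrable q volume 0 1)
    {yt pt : ℝ → ℝ → ℝ}
    (hyc : ContinuousOn (fun z : ℝ × ℝ => yt z.1 z.2) (Ici (0:ℝ) ×ˢ Icc (0:ℝ) 1))
    (hyd : ∀ t, 0 < t → ∀ x ∈ Icc (0:ℝ) 1, HasDerivAt (fun s => sol.ut s x) (yt t x) t)
    (hpc : ContinuousOn (fun z : ℝ × ℝ => pt z.1 z.2) (Ici (0:ℝ) ×ˢ Icc (0:ℝ) 1))
    (hpd : ∀ t, 0 < t → ∀ x ∈ Icc (0:ℝ) 1, HasDerivAt (fun s => sol.ux s x) (pt t x) t)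
    {h ψ : ℝ → ℝ} (hh : Continuous h) (hψ : Continuous ψ) (B : ℝ) {t : ℝ} (ht : 0 < t) :
    HasDerivAt (sol.perturbation h ψ B)
      ((∫ x in (0:ℝ)..1, h x * (yt t x * sol.ux t x + sol.ut t x * pt t x)) -
        B / 2 * (∫ x in (0:ℝ)..1, ψ x * (pt t x *
            ((∫ z in (0:ℝ)..x, sol.ut t z) + a 0 / μ₁ * sol.ζ₁ t) +
          sol.ux t x * (a x * sol.ux t x -
            ((∫ z in (0:ℝ)..x, q z * sol.ut t z) + a 0 * γ₁ / μ₁ * sol.ζ₁ t)))) +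
        (sol.η₁ t * (sol.η₁ t +
            β₁ / a 1 * ((∫ z in (0:ℝ)..1, sol.ut t z) + a 0 / μ₁ * sol.ζ₁ t)) +
          sol.η₂ t * (-α₁ * sol.η₁ t - α₂ * sol.η₂ t -
            β₁ / a 1 * ((∫ z in (0:ℝ)..1, q z * sol.ut t z) + a 0 * γ₁ / μ₁ * sol.ζ₁ t)))) t := by
  have h01 : (1:ℝ) ∈ Icc (0:ℝ) 1 := by simp
  have S := sol.waveSlice hac hq hyc hyd hpc hpd ht
  have h1 : ContinuousOn (fun z : ℝ × ℝ => sol.ut z.1 z.2) (Ici (0:ℝ) ×ˢ Icc (0:ℝ) 1) :=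
    sol.hut_C1.continuousOn
  have h2 : ContinuousOn (fun z : ℝ × ℝ => sol.ux z.1 z.2) (Ici (0:ℝ) ×ˢ Icc (0:ℝ) 1) :=
    sol.hux_C1.continuousOn
  have h3 : ContinuousOn (fun z : ℝ × ℝ => sol.ζ₁ z.1) (Ici (0:ℝ) ×ˢ Icc (0:ℝ) 1) :=
    sol.hζ₁C1.continuousOn.comp continuousOn_fst fun z hz => hz.1
  have h4 := (continuousOn_primitive_strip h1).add (h3.const_mul (a 0 / μ₁))
  have hu0 : ContinuousOn (fun z : ℝ × ℝ => sol.ux z.1 0) (Ici (0:ℝ) ×ˢ Icc (0:ℝ) 1) :=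
    h2.comp (f := fun z : ℝ × ℝ => (z.1, (0:ℝ))) (by fun_prop) fun z hz => ⟨hz.1, by simp⟩
  have h4' := (continuousOn_primitive_strip hyc).add
    (((h3.const_mul (-γ₁)).add (hu0.const_mul μ₁)).const_mul (a 0 / μ₁))
  have hprim : ∀ s, 0 < s → ∀ x ∈ Icc (0:ℝ) 1,
      HasDerivAt (fun r => (∫ z in (0:ℝ)..x, sol.ut r z) + a 0 / μ₁ * sol.ζ₁ r)
        ((∫ z in (0:ℝ)..x, yt s z) + a 0 / μ₁ * (-γ₁ * sol.ζ₁ s + μ₁ * sol.ux s 0)) s :=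
    fun s hs x hx => (hasDerivAt_integral_strip hx hs h1 hyc hyd).add
      ((sol.hode3 s hs.le).const_mul _)
  have hflux : ∀ x ∈ Icc (0:ℝ) 1,
      (∫ z in (0:ℝ)..x, yt t z) + a 0 / μ₁ * (-γ₁ * sol.ζ₁ t + μ₁ * sol.ux t 0) =
        a x * sol.ux t x -
          ((∫ z in (0:ℝ)..x, q z * sol.ut t z) + a 0 * γ₁ / μ₁ * sol.ζ₁ t) := by
    intro x hx
    have h5 := S.flux_eq hx
    have h6 : a 0 / μ₁ * (-γ₁ * sol.ζ₁ t + μ₁ * sol.ux t 0) =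
        a 0 * sol.ux t 0 - a 0 * γ₁ / μ₁ * sol.ζ₁ t := by field_simp; ring
    rw [h6]
    linarith
  have h5 := hasDerivAt_integral_strip (f := fun t x => h x * (sol.ut t x * sol.ux t x))
    (f' := fun t x => h x * (yt t x * sol.ux t x + sol.ut t x * pt t x)) h01 ht
    ((hh.comp continuous_snd).continuousOn.mul (h1.mul h2))
    ((hh.comp continuous_snd).continuousOn.mul ((hyc.mul h2).add (h1.mul hpc)))
    (fun s hs x hx => ((hyd s hs x hx).mul (hpd s hs x hx)).const_mul _)
  have h6 := hasDerivAt_integral_strip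
    (f := fun t x => ψ x * (sol.ux t x * ((∫ z in (0:ℝ)..x, sol.ut t z) + a 0 / μ₁ * sol.ζ₁ t)))
    (f' := fun t x => ψ x * (pt t x * ((∫ z in (0:ℝ)..x, sol.ut t z) + a 0 / μ₁ * sol.ζ₁ t) +
      sol.ux t x *
        ((∫ z in (0:ℝ)..x, yt t z) + a 0 / μ₁ * (-γ₁ * sol.ζ₁ t + μ₁ * sol.ux t 0)))) h01 ht
    ((hψ.comp continuous_snd).continuousOn.mul (h2.mul h4))
    ((hψ.comp continuous_snd).continuousOn.mul ((hpc.mul h4).add (h2.mul h4')))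
    (fun s hs x hx => ((hpd s hs x hx).mul (hprim s hs x hx)).const_mul _)
  rw [intervalIntegral.integral_congr (g := fun x => ψ x * (pt t x *
            ((∫ z in (0:ℝ)..x, sol.ut t z) + a 0 / μ₁ * sol.ζ₁ t) +
          sol.ux t x * (a x * sol.ux t x -
            ((∫ z in (0:ℝ)..x, q z * sol.ut t z) + a 0 * γ₁ / μ₁ * sol.ζ₁ t)))) (fun x hx => by
      rw [uIcc_of_le zero_le_one] at hx
      simp only [hflux x hx])] at h6
  have h7 := (sol.hode2 t ht.le).mul
    ((sol.hode1 t ht.le).add ((hprim t ht 1 h01).const_mul (β₁ / a 1)))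
  rw [hflux 1 h01] at h7
  refine ((h5.sub (h6.const_mul _)).add h7).congr_deriv ?_
  congr 2
  field_simp
  ring

end ClassicalSolutionS

/-- Exponential decay of the energy and uniform convergence of `u` towards `u_*` for
classical solutions of system (S), with constants depending only on the data. -/
theorem exponential_stability_S (a q : ℝ → ℝ) (a_min a_max c d q_min q_max α₁ α₂ β₁ γ₁ μ₁ : ℝ)
    (hA1 : AssumptionA1 a a_min a_max) (hA2 : AssumptionA2 q c d q_min q_max)
    (hα₁ : 0 < α₁) (hα₂ : 0 < α₂) (hβ₁ : 0 < β₁) (hγ₁ : 0 < γ₁) (hμ₁ : 0 < μ₁) :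
    ∃ M > (0:ℝ), ∃ ν > (0:ℝ), ∀ sol : ClassicalSolutionS a q α₁ α₂ β₁ γ₁ μ₁, ∀ t ∈ Ici (0:ℝ),
      energyS sol t ≤ M * energyS sol 0 * Real.exp (-ν * t) ∧
      ∀ x ∈ Icc (0:ℝ) 1,
        (sol.u t x - (sol.u 0 1 - sol.η₂ 0)) ^ 2 ≤ M * energyS sol 0 * Real.exp (-ν * t) := by
  have h01 : (1:ℝ) ∈ Icc (0:ℝ) 1 := by simp
  have hqi := hA2.intervalIntegrable
  obtain ⟨h, h', ψ, ψ', B, K, H, Q, W⟩ := exists_adaptedWeights hA1 hA2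
  obtain ⟨⟨L, hL⟩, hm, -, ha⟩ := hA1
  have hac : AbsolutelyContinuousOnInterval a 0 1 :=
    LipschitzOnWith.absolutelyContinuousOnInterval (K := L) (by rwa [uIcc_of_le zero_le_one])
  have hapos : ∀ x ∈ Icc (0:ℝ) 1, 0 < a x := fun x hx => hm.trans_le (ha x hx).1
  have ha0 : 0 < a 0 := hapos 0 (by simp)
  have ha1 : 0 < a 1 := hapos 1 h01
  have he₂ : 0 < a 1 * α₂ / (2 * β₁) := by positivity
  obtain ⟨C, hC, hdecay⟩ := W.exists_decay_estimate
  obtain ⟨C₀, hC₀, hbound⟩ := W.exists_functional_bound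
  obtain ⟨κ, hκ, C', hC', habs⟩ := exists_boundary_absorption (α₁ := α₁) (b := β₁ / a 1)
    (σ := a 0 / μ₁) (ρ := a 0 * γ₁ / μ₁) (e₁ := a 1 / (2 * β₁)) (e₃ := a 0 / (2 * μ₁))
    (A := a 1 * α₁ / β₁) (Z := a 0 * γ₁ / μ₁) hα₂ (by positivity) he₂ (by positivity)
    (by positivity) (by positivity) hC W.Q_nonneg
  obtain ⟨K', hK', hfun⟩ := exists_boundary_functional_bound (b := β₁ / a 1) (σ := a 0 / μ₁)
    (e₁ := a 1 / (2 * β₁)) (e₃ := a 0 / (2 * μ₁)) (by positivity) he₂ (by positivity) hC₀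
  obtain ⟨M, hM, ν, hν, hmain⟩ := exists_decay_of_perturbed_energy hκ hC' hK'
  set k := 3 / (a 1 * α₂ / (2 * β₁)) + 12 / a_min with hk
  have hk0 : 0 < k := by positivity
  refine ⟨(1 + k) * M, by positivity, ν, hν, fun sol t ht => ?_⟩
  have hE0 : ∀ t, 0 ≤ energyS sol t :=
    sol.energyS_nonneg hα₂.le hβ₁.le hμ₁.le fun x hx => (hapos x hx).le
  have hsq : ∀ t, 0 ≤ t → 0 ≤ (∫ x in (0:ℝ)..1, (sol.ut t x ^ 2 + a x * sol.ux t x ^ 2)) ∧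
      (∫ x in (0:ℝ)..1, sol.ut t x ^ 2) ≤
        ∫ x in (0:ℝ)..1, (sol.ut t x ^ 2 + a x * sol.ux t x ^ 2) := by
    intro t ht
    have hac' := W.a_cont
    have hy := continuousOn_slice sol.hut_C1.continuousOn (mem_Ici.2 ht)
    have hp := continuousOn_slice sol.hux_C1.continuousOn (mem_Ici.2 ht)
    constructor
    · refine intervalIntegral.integral_nonneg zero_le_one fun x hx => ?_
      have := hapos x hx
      positivity
    · refine integral_mono_of_ae_Ioo (intervalIntegrable_of_continuousOn_Icc h01 (by fun_prop))
        (intervalIntegrable_of_continuousOn_Icc h01 (by fun_prop)) ?_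
      filter_upwards [ae_restrict_mem measurableSet_Ioo] with x hx
      have := hapos x (Ioo_subset_Icc_self hx)
      have : 0 ≤ a x * sol.ux t x ^ 2 := by positivity
      linarith
  have hN : ∀ t, 0 ≤ ∫ x in (0:ℝ)..1, q x * sol.ut t x ^ 2 := by
    intro t
    refine intervalIntegral.integral_nonneg_of_ae_restrict zero_le_one ?_
    rw [← restrict_Ioo_eq_restrict_Icc]
    filter_upwards [W.q_bound] with x hx using mul_nonneg hx.1 (sq_nonneg _)
  obtain ⟨yt, hyc, hyd⟩ := sol.hut_C1.exists_partial_deriv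
  obtain ⟨pt, hpc, hpd⟩ := sol.hux_C1.exists_partial_deriv
  have hE := hmain (energyS sol) (sol.perturbation h ψ B) sol.dissipation _
    (sol.continuousOn_energyS W.a_cont) (sol.continuousOn_perturbation W.h_cont W.ψ_cont B)
    (fun s hs => sol.hasDerivAt_energyS hβ₁.ne' hμ₁.ne' hac hqi hs)
    (fun s hs => sol.hasDerivAt_perturbation ha0.ne' ha1.ne' hμ₁.ne' hac hqi hyc hyd hpc hpd
      W.h_cont W.ψ_cont B hs)
    (fun s _ => by
      have := hN s
      unfold ClassicalSolutionS.dissipation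
      positivity)
    (fun s _ => hE0 s)
    (fun s hs => by
      have S := sol.waveSlice hac hqi hyc hyd hpc hpd hs
      have h1 := hdecay S (a 0 / μ₁ * sol.ζ₁ s) (a 0 * γ₁ / μ₁ * sol.ζ₁ s)
      have h2 := habs _ _ (sol.η₁ s) (sol.η₂ s) (sol.ζ₁ s) _ _ (hsq s hs.le).1 (hN s)
        ((sq_primitive_le S.y_cont (a 0 / μ₁ * sol.ζ₁ s) h01).trans
          (by linarith [(hsq s hs.le).2]))
        (sq_damped_primitive_le hqi W.q_bound S.y_cont (a 0 * γ₁ / μ₁ * sol.ζ₁ s) h01)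
      unfold energyS ClassicalSolutionS.dissipation
      linarith)
    (fun s hs => by
      have hy := continuousOn_slice sol.hut_C1.continuousOn (mem_Ici.2 hs)
      have hp := continuousOn_slice sol.hux_C1.continuousOn (mem_Ici.2 hs)
      exact hfun _ _ (sol.η₁ s) (sol.η₂ s) (sol.ζ₁ s) _ (hsq s hs).1
        ((sq_primitive_le hy (a 0 / μ₁ * sol.ζ₁ s) h01).trans (by linarith [(hsq s hs).2]))
        (hbound hy hp (a 0 / μ₁ * sol.ζ₁ s)))
    t ht
  have hexp : 0 ≤ M * energyS sol 0 * Real.exp (-ν * t) :=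
    mul_nonneg (mul_nonneg hM.le (hE0 0)) (Real.exp_pos _).le
  have hsplit : (1 + k) * M * energyS sol 0 * Real.exp (-ν * t) =
      M * energyS sol 0 * Real.exp (-ν * t) + k * (M * energyS sol 0 * Real.exp (-ν * t)) := by
    ring
  have hkexp := mul_nonneg hk0.le hexp
  rw [hsplit]
  refine ⟨by linarith, fun x hx => ?_⟩
  have hu := sol.sq_displacement_le hm W.a_cont (fun x hx => (ha x hx).1) ht hx
  have hkE := mul_le_mul_of_nonneg_left hE hk0.le
  have hku : 3 * sol.η₂ t ^ 2 +
      6 / a_min * (∫ x in (0:ℝ)..1, (sol.ut t x ^ 2 + a x * sol.ux t x ^ 2)) ≤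
        k * energyS sol t := by
    have hI := (hsq t ht).1
    unfold energyS
    generalize (∫ x in (0:ℝ)..1, (sol.ut t x ^ 2 + a x * sol.ux t x ^ 2)) = I at hI ⊢
    have e : k * ((1 / 2) * I + (a 1 / (2 * β₁)) * sol.η₁ t ^ 2
          + (a 1 * α₂ / (2 * β₁)) * sol.η₂ t ^ 2 + (a 0 / (2 * μ₁)) * sol.ζ₁ t ^ 2) =
        3 * sol.η₂ t ^ 2 + 6 / a_min * I +
        (3 / (a 1 * α₂ / (2 * β₁)) * ((1 / 2) * I) +
          12 / a_min * ((a 1 * α₂ / (2 * β₁)) * sol.η₂ t ^ 2) +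
          k * ((a 1 / (2 * β₁)) * sol.η₁ t ^ 2 + (a 0 / (2 * μ₁)) * sol.ζ₁ t ^ 2)) := by
      rw [hk]
      field_simp
      ring
    have hp : 0 ≤ 3 / (a 1 * α₂ / (2 * β₁)) * ((1 / 2) * I) +
          12 / a_min * ((a 1 * α₂ / (2 * β₁)) * sol.η₂ t ^ 2) +
          k * ((a 1 / (2 * β₁)) * sol.η₁ t ^ 2 + (a 0 / (2 * μ₁)) * sol.ζ₁ t ^ 2) := by
      positivity
    linarith
  linarith
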